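/- Let 0 < ρ < 1 and N > 1 an integer. The measure μ_{ρ,N} is a spectral measure (L²(μ_{ρ,N}) has an orthonormal basis of exponentials) if and only if ρ = 1/q for some integer q > 1 with N ∣ q. -/

import Mathlib

open MeasureTheory Complex Real
open scoped ENNReal

/-- The Fourier transform `μ̂(ξ) = ∫ e^{-2πiξx} dμ(x)`. -/
noncomputable def FT (μ : Measure ℝ) (ξ : ℝ) : ℂ :=
  ∫ x, Complex.exp (-2 * Real.pi * Complex.I * ξ * x) ∂μ

/-- `μ` is the self-similar measure `μ(·) = (1/N) ∑_{j<N} μ(ρ⁻¹(·) − j)`. -/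
def IsSelfSimilar (ρ : ℝ) (N : ℕ) (μ : Measure ℝ) : Prop :=
  μ = (N : ℝ≥0∞)⁻¹ • ∑ j ∈ Finset.range N, μ.map (fun x => ρ * x + (j : ℝ))

/-- Orthonormality of the exponentials `e_λ, λ ∈ Λ`, in `L²(μ)`. -/
def ExpOrthonormal (μ : Measure ℝ) (Λ : Set ℝ) : Prop :=
  ∀ l ∈ Λ, ∀ l' ∈ Λ, FT μ (l - l') = if l = l' then 1 else 0

/-- Totality of the exponentials `e_λ, λ ∈ Λ`, in `L²(μ)`. -/
def ExpTotal (μ : Measure ℝ) (Λ : Set ℝ) : Prop :=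
  ∀ f : Lp ℂ 2 μ,
    (∀ l ∈ Λ, ∫ x, f x *
      (starRingEnd ℂ) (Complex.exp (-2 * Real.pi * Complex.I * l * x)) ∂μ = 0) → f = 0

/-- `μ` is a spectral measure: `L²(μ)` admits an orthonormal basis of
exponentials, i.e. a countable maximal orthonormal family `(e_λ)_{λ∈Λ}`. -/
def IsSpectral (μ : Measure ℝ) : Prop :=
  ∃ Λ : Set ℝ, Λ.Countable ∧ ExpOrthonormal μ Λ ∧ ExpTotal μ Λ

open scoped NNReal

/-- The zeros of the Fourier transform of the `N`-digit measure with ratio `ρ`, dilated by `N`. -/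
def zeroSet (ρ : ℝ) (N : ℕ) : Set ℝ :=
  {t | ∃ (n : ℕ) (a : ℤ), ¬ (N : ℤ) ∣ a ∧ t * ρ ^ n = a}

/-- Distinct elements of `Λ` differ by an element of `zeroSet ρ N`. -/
def IsBizero (ρ : ℝ) (N : ℕ) (Λ : Set ℝ) : Prop :=
  ∀ l ∈ Λ, ∀ l' ∈ Λ, l ≠ l' → l - l' ∈ zeroSet ρ N

/-- The properties of the squared moduli `M` of the mask and `F` of the Fourier transform
(both dilated by `N`) on which spectrality depends. -/
structure MaskSystem (ρ : ℝ) (N : ℕ) (M F : ℝ → ℝ≥0) : Prop where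
  scale : ∀ t, F t = M t * F (ρ * t)
  periodic : ∀ t, M (t + N) = M t
  sum_shift : ∀ t, ∑ i ∈ Finset.range N, M (t + i) = 1
  mask_ne_zero : ∀ t : ℝ, (∀ a : ℤ, t ≠ a) → M t ≠ 0
  ne_zero : ∀ t, t ∉ zeroSet ρ N → F t ≠ 0
  bessel : ∀ Λ, IsBizero ρ N Λ → ∀ x, ∑' l : Λ, (F (x + l) : ℝ≥0∞) ≤ 1
  gap : ∀ δ > (0 : ℝ), ∃ θ < (1 : ℝ≥0), ∀ t : ℝ, (∀ z : ℤ, δ ≤ |t - N * z|) → M t ≤ θ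

/-- The part of `Λ` whose elements in the class `κ + ℤ` are congruent to `κ + s κ` modulo `N`. -/
def selected (N : ℕ) (s : ℝ → ℕ) (Λ : Set ℝ) : Set ℝ :=
  {l ∈ Λ | ⌊l⌋ % (N : ℤ) = s (Int.fract l)}

/-- A set `Λ` at which the Bessel inequality is an equality at the point `x`, which is
transcendental enough for all the factors involved not to vanish. -/
structure IsFull (ρ : ℝ) (N : ℕ) (F : ℝ → ℝ≥0) (K : Subfield ℝ) (Λ : Set ℝ) (x : ℝ) :
    Prop where
  sub : ∀ l ∈ Λ, l ∈ K
  gen : x ∉ K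
  bizero : IsBizero ρ N Λ
  sum_eq : ∑' l : Λ, (F (x + l) : ℝ≥0∞) = 1

/-- The mass of the part of `Λ` congruent to `κ + i` modulo `N`, seen one scale further. -/
noncomputable def classMass (ρ : ℝ) (N : ℕ) (F : ℝ → ℝ≥0) (Λ : Set ℝ) (x κ : ℝ) (i : ℕ) : ℝ≥0∞ :=
  ∑' l : ℝ, {l ∈ Λ | Int.fract l = κ ∧ ⌊l⌋ % (N : ℤ) = i}.indicator
    (fun l => (F (ρ * (x + l)) : ℝ≥0∞)) l

section

variable {ρ : ℝ} {N : ℕ} {M F : ℝ → ℝ≥0} {K : Subfield ℝ} {Λ : Set ℝ} {x : ℝ}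

lemma MaskSystem.periodic_int (h : MaskSystem ρ N M F) (t : ℝ) (z : ℤ) : M (t + N * z) = M t := by
  have hp : Function.Periodic M (N : ℝ) := h.periodic
  have := hp.int_mul z t
  rw [mul_comm] at this
  exact this

lemma tsum_selected (s : ℝ → ℕ) :
    ∑' l : selected N s Λ, (F (ρ * (x + l)) : ℝ≥0∞) = ∑' κ : ℝ, classMass ρ N F Λ x κ (s κ) := by
  rw [tsum_subtype (selected N s Λ) (fun l => (F (ρ * (x + l)) : ℝ≥0∞))]
  unfold classMass
  rw [ENNReal.tsum_comm]
  refine tsum_congr fun l => ?_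
  rw [tsum_eq_single (Int.fract l)]
  · classical
    simp only [Set.indicator_apply, selected, Set.mem_ofPred_eq, true_and]
  · intro κ hκ
    rw [Set.indicator_of_notMem]
    rintro ⟨-, h, -⟩
    exact hκ h.symm

lemma MaskSystem.tsum_eq_classMass (h : MaskSystem ρ N M F) (hN : 0 < N) :
    ∑' l : Λ, (F (x + l) : ℝ≥0∞) =
      ∑' κ : ℝ, ∑ i ∈ Finset.range N, (M (x + κ + i) : ℝ≥0∞) * classMass ρ N F Λ x κ i := by
  classical
  rw [tsum_subtype Λ (fun l => (F (x + l) : ℝ≥0∞))]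
  unfold classMass
  simp_rw [← ENNReal.tsum_mul_left]
  have : ∀ κ : ℝ, ∑ i ∈ Finset.range N, ∑' l : ℝ, (M (x + κ + i) : ℝ≥0∞) *
      {l ∈ Λ | Int.fract l = κ ∧ ⌊l⌋ % (N : ℤ) = i}.indicator
        (fun l => (F (ρ * (x + l)) : ℝ≥0∞)) l = ∑' l : ℝ, ∑ i ∈ Finset.range N,
      (M (x + κ + i) : ℝ≥0∞) * {l ∈ Λ | Int.fract l = κ ∧ ⌊l⌋ % (N : ℤ) = i}.indicator
        (fun l => (F (ρ * (x + l)) : ℝ≥0∞)) l := fun κ =>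
    (Summable.tsum_finsetSum fun _ _ => ENNReal.summable).symm
  simp_rw [this]
  rw [ENNReal.tsum_comm]
  refine tsum_congr fun l => ?_
  have hN' : (0 : ℤ) < N := by exact_mod_cast hN
  obtain ⟨j, hj⟩ := Int.eq_ofNat_of_zero_le (Int.emod_nonneg ⌊l⌋ hN'.ne')
  have hjN : j < N := by
    have := Int.emod_lt_of_pos ⌊l⌋ hN'
    omega
  rw [tsum_eq_single (Int.fract l), Finset.sum_eq_single j]
  · by_cases hl : l ∈ Λ
    · rw [Set.indicator_of_mem hl, Set.indicator_of_mem (by exact ⟨hl, rfl, hj⟩), h.scale]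
      have : x + l = x + Int.fract l + j + N * (⌊l⌋ / (N : ℤ) : ℤ) := by
        have h1 := Int.emod_add_mul_ediv ⌊l⌋ N
        rw [hj] at h1
        have h2 : (j : ℝ) + N * (⌊l⌋ / (N : ℤ) : ℤ) = ⌊l⌋ := by exact_mod_cast h1
        have h3 := Int.floor_add_fract l
        linarith
      have h4 := h.periodic_int (x + Int.fract l + j) (⌊l⌋ / (N : ℤ))
      rw [← this] at h4
      rw [h4]
      push_cast
      rfl
    · rw [Set.indicator_of_notMem hl, Set.indicator_of_notMem (fun hh => hl hh.1), mul_zero]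
  · intro i _ hij
    rw [Set.indicator_of_notMem, mul_zero]
    rintro ⟨-, -, h'⟩
    rw [hj] at h'
    exact hij (by exact_mod_cast h'.symm)
  · intro hj'
    exact absurd (Finset.mem_range.2 hjN) hj'
  · intro κ hκ
    refine Finset.sum_eq_zero fun i _ => ?_
    rw [Set.indicator_of_notMem, mul_zero]
    rintro ⟨-, h', -⟩
    exact hκ h'.symm

lemma IsBizero.select (hρ : 0 < ρ) (hΛ : IsBizero ρ N Λ) (s : ℝ → ℕ) :
    IsBizero ρ N ((· / ρ) ⁻¹' selected N s Λ) := by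
  intro l hl l' hl' hne
  obtain ⟨hl, h1⟩ := hl
  obtain ⟨hl', h2⟩ := hl'
  obtain ⟨n, a, ha, h⟩ := hΛ _ hl _ hl' (fun h => hne (by field_simp at h; exact h))
  cases n with
  | zero =>
    exfalso
    rw [pow_zero, mul_one] at h
    have hfr : Int.fract (l / ρ) = Int.fract (l' / ρ) :=
      Int.fract_eq_fract.2 ⟨a, h⟩
    have h3 : ⌊l / ρ⌋ - ⌊l' / ρ⌋ = a := by
      have e1 := Int.floor_add_fract (l / ρ)
      have e2 := Int.floor_add_fract (l' / ρ)
      have : ((⌊l / ρ⌋ : ℝ) - ⌊l' / ρ⌋) = a := by linarith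
      exact_mod_cast this
    refine ha ?_
    rw [← h3]
    apply Int.ModEq.dvd
    change _ % _ = _ % _
    rw [h1, h2, hfr]
  | succ n =>
    refine ⟨n, a, ha, ?_⟩
    rw [← h, pow_succ]
    field_simp

lemma tsum_preimage_div (hρ : 0 < ρ) (S : Set ℝ) :
    ∑' l : ((· / ρ) ⁻¹' S : Set ℝ), (F (ρ * x + l) : ℝ≥0∞) =
      ∑' l : S, (F (ρ * (x + l)) : ℝ≥0∞) := by
  classical
  rw [tsum_subtype ((· / ρ) ⁻¹' S) (fun l => (F (ρ * x + l) : ℝ≥0∞)),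
    tsum_subtype S (fun l => (F (ρ * (x + l)) : ℝ≥0∞)),
    ← (Equiv.mulLeft₀ ρ hρ.ne').tsum_eq]
  refine tsum_congr fun l => ?_
  simp only [Equiv.mulLeft₀_apply, Set.indicator_apply, Set.mem_preimage,
    mul_div_cancel_left₀ _ hρ.ne',
    mul_add]

lemma MaskSystem.tsum_classMass_le (h : MaskSystem ρ N M F) (hρ : 0 < ρ)
    (hΛ : IsBizero ρ N Λ) (s : ℝ → ℕ) : ∑' κ : ℝ, classMass ρ N F Λ x κ (s κ) ≤ 1 := by
  rw [← tsum_selected, ← tsum_preimage_div hρ]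
  exact h.bessel _ (hΛ.select hρ s) _

lemma IsFull.classMass_eq (h : MaskSystem ρ N M F) (hN : 0 < N) (hρ : 0 < ρ)
    (hΛ : IsFull ρ N F K Λ x) (κ : ℝ) {i j : ℕ} (hi : i < N) (hj : j < N) :
    classMass ρ N F Λ x κ i = classMass ρ N F Λ x κ j := by
  classical
  have hne : (Finset.range N).Nonempty := ⟨0, Finset.mem_range.2 hN⟩
  choose s hs hmax using fun κ => Finset.exists_max_image (Finset.range N)
    (classMass ρ N F Λ x κ) hne
  have hle := h.tsum_classMass_le (x := x) hρ hΛ.bizero s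
  have hM : ∀ t, ∑ i ∈ Finset.range N, (M (t + i) : ℝ≥0∞) = 1 := fun t => by
    exact_mod_cast h.sum_shift t
  have hpt : ∀ κ, ∑ i ∈ Finset.range N, (M (x + κ + i) : ℝ≥0∞) * classMass ρ N F Λ x κ i ≤
      classMass ρ N F Λ x κ (s κ) := fun κ => by
    calc _ ≤ ∑ i ∈ Finset.range N, (M (x + κ + i) : ℝ≥0∞) * classMass ρ N F Λ x κ (s κ) :=
          Finset.sum_le_sum fun i hi => by gcongr; exact hmax κ i hi
      _ = _ := by rw [← Finset.sum_mul, hM, one_mul]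
  have hsum := hΛ.sum_eq
  rw [h.tsum_eq_classMass hN] at hsum
  have hfin : ∀ κ, classMass ρ N F Λ x κ (s κ) ≠ ∞ := fun κ =>
    ((ENNReal.le_tsum κ).trans hle).trans_lt ENNReal.one_lt_top |>.ne
  have heq : ∑ i ∈ Finset.range N, (M (x + κ + i) : ℝ≥0∞) * classMass ρ N F Λ x κ i =
      classMass ρ N F Λ x κ (s κ) := by
    by_contra hlt
    have := ENNReal.tsum_lt_tsum (by rw [hsum]; simp) hpt (lt_of_le_of_ne (hpt κ) hlt)
    rw [hsum] at this
    exact absurd hle (not_le.2 this)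
  by_cases hcl : ∃ l ∈ Λ, Int.fract l = κ
  · obtain ⟨l, hl, rfl⟩ := hcl
    have key : ∀ i < N, classMass ρ N F Λ x (Int.fract l) i =
        classMass ρ N F Λ x (Int.fract l) (s (Int.fract l)) := by
      intro i hi
      by_contra hlt
      have hi' := Finset.mem_range.2 hi
      have hlt := lt_of_le_of_ne (hmax _ i hi') hlt
      have hM0 : M (x + Int.fract l + i) ≠ 0 := by
        refine h.mask_ne_zero _ fun a ha => hΛ.gen ?_
        have : x = a - i - (l - ⌊l⌋) := by
          rw [← ha, Int.self_sub_floor]; ring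
        rw [this]
        exact sub_mem (sub_mem (intCast_mem K a) (natCast_mem K i))
          (sub_mem (hΛ.sub l hl) (intCast_mem K _))
      have : ∑ i ∈ Finset.range N, (M (x + Int.fract l + i) : ℝ≥0∞) *
            classMass ρ N F Λ x (Int.fract l) i <
          ∑ i ∈ Finset.range N, (M (x + Int.fract l + i) : ℝ≥0∞) *
            classMass ρ N F Λ x (Int.fract l) (s (Int.fract l)) := by
        have hfin2 : ∀ i ∈ Finset.range N, (M (x + Int.fract l + i) : ℝ≥0∞) *
            classMass ρ N F Λ x (Int.fract l) (s (Int.fract l)) ≠ ∞ := fun i _ =>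
          ENNReal.mul_ne_top ENNReal.coe_ne_top (hfin _)
        refine (ENNReal.toReal_lt_toReal (ENNReal.sum_ne_top.2 fun i hi => ?_)
          (ENNReal.sum_ne_top.2 hfin2)).1 ?_
        · exact ne_top_of_le_ne_top (hfin2 i hi) (by gcongr; exact hmax _ i hi)
        · rw [ENNReal.toReal_sum (fun i hi => ne_top_of_le_ne_top (hfin2 i hi)
            (by gcongr; exact hmax _ i hi)), ENNReal.toReal_sum hfin2]
          refine Finset.sum_lt_sum (fun i hi => ?_) ⟨i, hi', ?_⟩
          · exact ENNReal.toReal_mono (hfin2 i hi) (by gcongr; exact hmax _ i hi)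
          · refine ENNReal.toReal_strict_mono (hfin2 i hi') ?_
            exact ENNReal.mul_lt_mul_right (by exact_mod_cast hM0) ENNReal.coe_ne_top hlt
      rw [heq, ← Finset.sum_mul, hM, one_mul] at this
      exact lt_irrefl _ this
    rw [key i hi, key j hj]
  · have : ∀ i, classMass ρ N F Λ x κ i = 0 := fun i => by
      unfold classMass
      rw [ENNReal.tsum_eq_zero]
      intro l
      rw [Set.indicator_of_notMem]
      rintro ⟨hl, h', -⟩
      exact hcl ⟨l, hl, h'⟩
    rw [this, this]

lemma IsFull.select (h : MaskSystem ρ N M F) (hN : 0 < N) (hρ : 0 < ρ) (hK : ρ ∈ K)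
    (hΛ : IsFull ρ N F K Λ x) (s : ℝ → ℕ) (hs : ∀ κ, s κ < N) :
    IsFull ρ N F K ((· / ρ) ⁻¹' selected N s Λ) (ρ * x) where
  sub l hl := by
    have := mul_mem (hΛ.sub _ hl.1) hK
    rwa [div_mul_cancel₀ _ hρ.ne'] at this
  gen hx := hΛ.gen (by
    have := div_mem hx hK
    rwa [mul_div_cancel_left₀ _ hρ.ne'] at this)
  bizero := hΛ.bizero.select hρ s
  sum_eq := by
    rw [tsum_preimage_div hρ, tsum_selected, ← hΛ.sum_eq, h.tsum_eq_classMass hN]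
    refine tsum_congr fun κ => ?_
    calc classMass ρ N F Λ x κ (s κ) = ∑ i ∈ Finset.range N, (M (x + κ + i) : ℝ≥0∞) *
          classMass ρ N F Λ x κ (s κ) := by
          rw [← Finset.sum_mul]
          have : ∑ i ∈ Finset.range N, (M (x + κ + i) : ℝ≥0∞) = 1 := by
            exact_mod_cast h.sum_shift _
          rw [this, one_mul]
      _ = _ := Finset.sum_congr rfl fun i hi => by
          rw [hΛ.classMass_eq h hN hρ κ (hs κ) (Finset.mem_range.1 hi)]

end

section

variable {ρ : ℝ} {N : ℕ} {M F : ℝ → ℝ≥0} {K : Subfield ℝ} {Λ : Set ℝ} {x : ℝ}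

lemma zeroSet_subset (hρ : 0 < ρ) (hK : ρ ∈ K) {t : ℝ} (ht : t ∈ zeroSet ρ N) : t ∈ K := by
  obtain ⟨n, a, -, h⟩ := ht
  rw [eq_div_of_mul_eq (pow_pos hρ n).ne' h]
  exact div_mem (intCast_mem K a) (pow_mem hK n)

lemma MaskSystem.ne_zero_of_notMem (h : MaskSystem ρ N M F) (hρ : 0 < ρ) (hK : ρ ∈ K) {t : ℝ}
    (ht : t ∉ K) : F t ≠ 0 :=
  h.ne_zero t fun ht' => ht (zeroSet_subset hρ hK ht')

lemma IsFull.scaled_notMem (hρ : 0 < ρ) (hK : ρ ∈ K) (hΛ : IsFull ρ N F K Λ x) : ρ * x ∉ K :=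
  fun hx => hΛ.gen (by
    have := div_mem hx hK
    rwa [mul_div_cancel_left₀ _ hρ.ne'] at this)

lemma IsFull.exists_int_mem (h : MaskSystem ρ N M F) (hρ : 0 < ρ) (hK : ρ ∈ K)
    (hΛ : IsFull ρ N F K Λ x) (h0 : (0 : ℝ) ∈ Λ) {i : ℕ} (hi : i < N) :
    ∃ a : ℤ, a % N = i ∧ (a : ℝ) ∈ Λ := by
  have hN : 0 < N := by omega
  have hpos : classMass ρ N F Λ x 0 0 ≠ 0 := by
    intro hz
    unfold classMass at hz
    rw [ENNReal.tsum_eq_zero] at hz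
    have := hz 0
    rw [Set.indicator_of_mem (by simp [h0])] at this
    rw [add_zero] at this
    exact h.ne_zero_of_notMem hρ hK (hΛ.scaled_notMem hρ hK) (by exact_mod_cast this)
  rw [hΛ.classMass_eq h hN hρ 0 hN hi] at hpos
  unfold classMass at hpos
  rw [Ne, ENNReal.tsum_eq_zero, not_forall] at hpos
  obtain ⟨l, hl⟩ := hpos
  obtain ⟨hlΛ, hfr, hmod⟩ := Set.mem_of_indicator_ne_zero hl
  refine ⟨⌊l⌋, hmod, ?_⟩
  have : (⌊l⌋ : ℝ) = l := by
    have := Int.floor_add_fract l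
    rw [hfr, add_zero] at this
    exact this
  rwa [this]

lemma zero_mem_selected (h0 : (0 : ℝ) ∈ Λ) :
    (0 : ℝ) ∈ ((· / ρ) ⁻¹' selected N (fun _ => 0) Λ : Set ℝ) := by
  simp [selected, h0]

lemma IsFull.exists_mem_selected (h : MaskSystem ρ N M F) (hN : 1 < N) (hρ : 0 < ρ) (hK : ρ ∈ K)
    (hΛ : IsFull ρ N F K Λ x) (h0 : (0 : ℝ) ∈ Λ) :
    ∃ l ∈ Λ, ∃ a : ℤ, a % N = 1 ∧ ⌊l⌋ % (N : ℤ) = 0 ∧ l * ρ = a := by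
  have hN0 : 0 < N := by omega
  obtain ⟨a, ha, hl⟩ := (hΛ.select h hN0 hρ hK (fun _ => 0) fun _ => hN0).exists_int_mem h hρ hK
    (zero_mem_selected h0) hN
  exact ⟨a / ρ, hl.1, a, by exact_mod_cast ha, by exact_mod_cast hl.2,
    div_mul_cancel₀ _ hρ.ne'⟩

lemma IsFull.exists_mem_pow (h : MaskSystem ρ N M F) (hN : 1 < N) (hρ : 0 < ρ) (hK : ρ ∈ K)
    (n : ℕ) : ∀ (Λ : Set ℝ) (x : ℝ), IsFull ρ N F K Λ x → (0 : ℝ) ∈ Λ →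
      ∃ l ∈ Λ, ∃ a : ℤ, a % N = 1 ∧ l * ρ ^ n = a := by
  have hN0 : 0 < N := by omega
  induction n with
  | zero =>
    intro Λ x hΛ h0
    obtain ⟨a, ha, hl⟩ := hΛ.exists_int_mem h hρ hK h0 hN
    exact ⟨a, hl, a, by exact_mod_cast ha, by simp⟩
  | succ n ih =>
    intro Λ x hΛ h0
    obtain ⟨l, hl, a, ha, hla⟩ := ih _ _ (hΛ.select h hN0 hρ hK (fun _ => 0) fun _ => hN0)
      (zero_mem_selected h0)
    refine ⟨l / ρ, hl.1, a, ha, ?_⟩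
    rw [← hla, pow_succ]
    field_simp

/-- If `ρ` is irrational, moving the selected part of `ℤ` changes only one term in the balance
between the residue classes at the next scale. -/
lemma IsFull.not_irrational (h : MaskSystem ρ N M F) (hN : 1 < N) (hρ : 0 < ρ) (hK : ρ ∈ K)
    (hΛ : IsFull ρ N F K Λ x) (h0 : (0 : ℝ) ∈ Λ) : ¬ Irrational ρ := by
  classical
  intro hirr
  have hN0 : 0 < N := by omega
  set s : ℝ → ℕ := fun κ => if κ = 0 then 1 else 0 with hs
  have hsN : ∀ κ, s κ < N := fun κ => by
    simp only [hs]
    split_ifs <;> omega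
  have h₀ := (hΛ.select h hN0 hρ hK (fun _ => 0) fun _ => hN0).classMass_eq h hN0 hρ 0 hN0 hN
  have h₁ := (hΛ.select h hN0 hρ hK s hsN).classMass_eq h hN0 hρ 0 hN0 hN
  have hmem : ∀ l : ℝ, l ≠ 0 → Int.fract l = 0 →
      (l ∈ ((· / ρ) ⁻¹' selected N s Λ : Set ℝ) ↔
        l ∈ ((· / ρ) ⁻¹' selected N (fun _ => 0) Λ : Set ℝ)) := by
    intro l hl hfr
    have : Int.fract (l / ρ) ≠ 0 := by
      intro hz
      obtain ⟨a, ha⟩ := Int.fract_eq_zero_iff.1 hfr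
      obtain ⟨b, hb⟩ := Int.fract_eq_zero_iff.1 hz
      refine hirr ⟨(a : ℚ) / b, ?_⟩
      have hb0 : (b : ℝ) ≠ 0 := by
        rw [hb]
        exact div_ne_zero hl hρ.ne'
      push_cast
      rw [div_eq_iff hb0, hb, ha]
      field_simp
    simp [selected, hs, this]
  have e1 : classMass ρ N F ((· / ρ) ⁻¹' selected N (fun _ => 0) Λ) (ρ * x) 0 1 =
      classMass ρ N F ((· / ρ) ⁻¹' selected N s Λ) (ρ * x) 0 1 := by
    unfold classMass
    refine tsum_congr fun l => ?_
    congr 1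
    ext l
    simp only [Set.mem_ofPred_eq]
    by_cases hl : l = 0
    · subst hl
      simp
    · constructor
      · rintro ⟨h1, h2, h3⟩
        exact ⟨(hmem l hl h2).2 h1, h2, h3⟩
      · rintro ⟨h1, h2, h3⟩
        exact ⟨(hmem l hl h2).1 h1, h2, h3⟩
  have e0 : classMass ρ N F ((· / ρ) ⁻¹' selected N (fun _ => 0) Λ) (ρ * x) 0 0 =
      classMass ρ N F ((· / ρ) ⁻¹' selected N s Λ) (ρ * x) 0 0 + F (ρ * (ρ * x)) := by
    unfold classMass
    have : (F (ρ * (ρ * x)) : ℝ≥0∞) = ∑' l : ℝ, if l = 0 then (F (ρ * (ρ * x)) : ℝ≥0∞) else 0 :=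
      (tsum_ite_eq (0 : ℝ) (fun _ => (F (ρ * (ρ * x)) : ℝ≥0∞))).symm
    rw [this, ← ENNReal.tsum_add]
    refine tsum_congr fun l => ?_
    by_cases hl : l = 0
    · subst hl
      rw [Set.indicator_of_mem, Set.indicator_of_notMem]
      · simp
      · rintro ⟨h1, -⟩
        have := h1.2
        simp [hs] at this
      · exact ⟨zero_mem_selected h0, by simp, by simp⟩
    · rw [if_neg hl, add_zero]
      simp only [Set.indicator_apply]
      refine if_congr ?_ rfl rfl
      constructor
      · rintro ⟨h1, h2, h3⟩
        exact ⟨(hmem l hl h2).2 h1, h2, h3⟩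
      · rintro ⟨h1, h2, h3⟩
        exact ⟨(hmem l hl h2).1 h1, h2, h3⟩
  rw [e0, e1, ← h₁] at h₀
  have hfin : classMass ρ N F ((· / ρ) ⁻¹' selected N s Λ) (ρ * x) 0 0 ≠ ∞ := by
    have := (ENNReal.le_tsum (0 : ℝ)).trans (h.tsum_classMass_le (x := ρ * x) hρ
      (hΛ.select h hN0 hρ hK s hsN).bizero fun _ => 0)
    exact ne_top_of_le_ne_top ENNReal.one_ne_top this
  have hz : (F (ρ * (ρ * x)) : ℝ≥0∞) = 0 := by
    have := ENNReal.add_right_inj hfin (b := (F (ρ * (ρ * x)) : ℝ≥0∞)) (c := 0)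
    rw [add_zero] at this
    exact this.1 h₀
  exact h.ne_zero_of_notMem hρ hK
    ((hΛ.select h hN0 hρ hK s hsN).scaled_notMem hρ hK) (by exact_mod_cast hz)

lemma rat_mul_pow {p q : ℕ} (hq : 0 < q) (hpq : ρ = p / q) (t : ℝ) (n : ℕ) (a : ℤ) :
    t * ρ ^ n = a ↔ t * p ^ n = a * q ^ n := by
  have : (q : ℝ) ^ n ≠ 0 := pow_ne_zero _ (by positivity)
  rw [hpq, div_pow, mul_div_assoc', div_eq_iff this]

lemma IsFull.not_coprime (h : MaskSystem ρ N M F) (hN : 1 < N) (hρ : 0 < ρ) (hK : ρ ∈ K)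
    (hΛ : IsFull ρ N F K Λ x) (h0 : (0 : ℝ) ∈ Λ) {p q : ℕ} (hq : 1 < q) (hpq : ρ = p / q)
    (hc : p.Coprime q) : ¬ q.Coprime N := by
  intro hqN
  have hq0 : 0 < q := by omega
  by_cases hpN : p.Coprime N
  · obtain ⟨l, hl, a, ha, hfl, hla⟩ := hΛ.exists_mem_selected h hN hρ hK h0
    have hla' := (rat_mul_pow hq0 hpq l 1 a).1 (by rwa [pow_one])
    rw [pow_one, pow_one] at hla'
    obtain ⟨b, hb⟩ := Int.mod_coprime hpN
    have hb' : (N : ℤ) ∣ p * b - 1 := hb.symm.dvd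
    obtain ⟨i, hi⟩ := Int.eq_ofNat_of_zero_le
      (Int.emod_nonneg (b * q * a) (by omega : (N : ℤ) ≠ 0))
    have hiN : i < N := by
      have := Int.emod_lt_of_pos (b * q * a) (by omega : (0 : ℤ) < N)
      omega
    obtain ⟨u, hu, huΛ⟩ := hΛ.exists_int_mem h hρ hK h0 hiN
    have hub : (N : ℤ) ∣ b * q * a - u := by
      apply Int.ModEq.dvd
      change u % N = _ % _
      rw [hu, hi]
    have hN1 : (N : ℤ) ∣ a * q - u * p := by
      have : a * q - u * p = p * (b * q * a - u) - (p * b - 1) * (a * q) := by ring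
      rw [this]
      exact dvd_sub (hub.mul_left _) (hb'.mul_right _)
    by_cases hlu : l = u
    · rw [hlu, Int.floor_intCast] at hfl
      rw [hlu] at hla'
      have h1 : u * p = a * q := by exact_mod_cast hla'
      have h2 : (N : ℤ) ∣ a * q := h1 ▸ (Int.dvd_of_emod_eq_zero hfl).mul_right _
      have h3 : (N : ℤ) ∣ a := IsCoprime.dvd_of_dvd_mul_right
        (Nat.isCoprime_iff_coprime.2 hqN.symm) h2
      rw [Int.emod_eq_zero_of_dvd h3] at ha
      omega
    · obtain ⟨k, c, hc', hk⟩ := hΛ.bizero l hl u huΛ hlu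
      have hk' := (rat_mul_pow hq0 hpq _ k c).1 hk
      have h1 : (a * q - u * p) * p ^ k = c * (q ^ k * p) := by
        have : ((a : ℝ) * q - u * p) * p ^ k = c * (q ^ k * p) := by
          rw [← hla', ← mul_assoc, ← hk']; ring
        exact_mod_cast this
      have h2 : (N : ℤ) ∣ c * (q ^ k * p) := h1 ▸ hN1.mul_right _
      refine hc' (IsCoprime.dvd_of_dvd_mul_right ?_ h2)
      exact ((Nat.isCoprime_iff_coprime.2 hqN.symm).pow_right).mul_right
        (Nat.isCoprime_iff_coprime.2 hpN.symm)
  · obtain ⟨r, hr, hrp, hrN⟩ := Nat.Prime.not_coprime_iff_dvd.1 hpN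
    have hrq : ¬ r ∣ q := fun hrq => hr.one_lt.ne' (Nat.eq_one_of_dvd_coprimes hc hrp hrq)
    have hr' : Prime (r : ℤ) := Nat.prime_iff_prime_int.1 hr
    obtain ⟨u, hu, huΛ⟩ := hΛ.exists_int_mem h hρ hK h0 hN
    have hu0 : u ≠ 0 := by
      rintro rfl
      simp at hu
    have hra : ∀ a : ℤ, a % N = 1 → ∀ n : ℕ, ¬ (r : ℤ) ∣ a * q ^ n := by
      intro a ha n hd
      rcases hr'.dvd_or_dvd hd with hd | hd
      · have h1 : (r : ℤ) ∣ a % N := by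
          rw [Int.emod_def]
          exact dvd_sub hd ((Int.natCast_dvd_natCast.2 hrN).mul_right _)
        rw [ha] at h1
        exact hr'.not_dvd_one h1
      · exact hrq (Int.natCast_dvd_natCast.1 (hr'.dvd_of_dvd_pow hd))
    have key : ∀ n : ℕ, 1 ≤ n → (q : ℤ) ^ n ∣ u := by
      intro n hn
      obtain ⟨l, hl, a, ha, hla⟩ := IsFull.exists_mem_pow h hN hρ hK n Λ x hΛ h0
      have hla' := (rat_mul_pow hq0 hpq l n a).1 hla
      have hrpn : (r : ℤ) ∣ p ^ n := dvd_pow (Int.natCast_dvd_natCast.2 hrp) (by omega)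
      have hlu : l ≠ u := by
        rintro rfl
        have h1 : u * p ^ n = a * q ^ n := by exact_mod_cast hla'
        exact hra a ha n (h1 ▸ hrpn.mul_left _)
      obtain ⟨k, c, hc', hk⟩ := hΛ.bizero l hl u huΛ hlu
      have hk' := (rat_mul_pow hq0 hpq _ k c).1 hk
      have h1 : (a * q ^ n - u * p ^ n) * p ^ k = c * q ^ k * p ^ n := by
        have : ((a : ℝ) * q ^ n - u * p ^ n) * p ^ k = c * q ^ k * p ^ n := by
          rw [← hla', ← hk']; ring
        exact_mod_cast this
      have hp0 : (p : ℤ) ≠ 0 := by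
        rintro hp
        have : p = 0 := by exact_mod_cast hp
        rw [this] at hpq
        simp [hpq] at hρ
      have hcop : IsCoprime ((q : ℤ) ^ n) ((p : ℤ) ^ (k - n) * p ^ n) :=
        ((Nat.isCoprime_iff_coprime.2 hc.symm).pow).mul_right
          ((Nat.isCoprime_iff_coprime.2 hc.symm).pow)
      rcases lt_or_ge k n with hkn | hkn
      · exfalso
        obtain ⟨m, rfl⟩ := Nat.exists_eq_add_of_lt hkn
        have h2 : a * q ^ (k + m + 1) - u * p ^ (k + m + 1) = c * q ^ k * p ^ (m + 1) := by
          apply mul_right_cancel₀ (pow_ne_zero k hp0)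
          rw [h1]; ring
        refine hra a ha (k + m + 1) ?_
        have h3 : a * (q : ℤ) ^ (k + m + 1) = c * q ^ k * p ^ (m + 1) + u * p ^ (k + m + 1) := by
          linarith
        rw [h3]
        exact dvd_add ((dvd_pow (Int.natCast_dvd_natCast.2 hrp) (by omega)).mul_left _)
          (hrpn.mul_left _)
      · obtain ⟨m, rfl⟩ := Nat.exists_eq_add_of_le hkn
        have h2 : (a * q ^ n - u * p ^ n) * p ^ m = c * q ^ (n + m) := by
          apply mul_right_cancel₀ (pow_ne_zero n hp0)
          rw [← h1]; ring
        rw [Nat.add_sub_cancel_left] at hcop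
        refine hcop.dvd_of_dvd_mul_right ?_
        have h3 : u * ((p : ℤ) ^ m * p ^ n) = q ^ n * (a * p ^ m - c * q ^ m) := by
          have : (c * q ^ (n + m) : ℤ) = q ^ n * (c * q ^ m) := by ring
          rw [this] at h2
          linear_combination (-1 : ℤ) * h2
        rw [h3]
        exact dvd_mul_right _ _
    obtain ⟨n, hn⟩ := pow_unbounded_of_one_lt |u| (by exact_mod_cast hq : (1 : ℤ) < q)
    have h1 := Int.le_of_dvd (abs_pos.2 hu0) ((dvd_abs _ _).2 (key (n + 1) (by omega)))
    have h2 : (q : ℤ) ^ n ≤ q ^ (n + 1) := pow_le_pow_right₀ (by omega) (by omega)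
    linarith

lemma IsFull.integral_of_not_coprime (h : MaskSystem ρ N M F) (hN : 1 < N) (hρ : 0 < ρ)
    (hK : ρ ∈ K) (hΛ : IsFull ρ N F K Λ x) (h0 : (0 : ℝ) ∈ Λ) {p q : ℕ} (hq : 1 < q)
    (hpq : ρ = p / q) (hc : p.Coprime q) (hqN : ¬ q.Coprime N) :
    ∀ l ∈ Λ, ∃ z : ℤ, l = z := by
  intro l hl
  by_contra hlz
  push Not at hlz
  have hq0 : 0 < q := by omega
  obtain ⟨u, hu, huΛ⟩ := hΛ.exists_int_mem h hρ hK h0 hN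
  obtain ⟨k, c, -, hk⟩ := hΛ.bizero l hl u huΛ (hlz u)
  obtain ⟨m, b, -, hm⟩ := hΛ.bizero l hl 0 h0 (by exact_mod_cast hlz 0)
  rw [sub_zero] at hm
  have hk0 : k ≠ 0 := by
    rintro rfl
    refine hlz (c + u) ?_
    push_cast
    rw [pow_zero, mul_one] at hk
    linarith
  have hm0 : m ≠ 0 := by
    rintro rfl
    refine hlz b ?_
    rwa [pow_zero, mul_one] at hm
  have hk' := (rat_mul_pow hq0 hpq _ k c).1 hk
  have hm' := (rat_mul_pow hq0 hpq _ m b).1 hm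
  have h1 : u * (p ^ m * p ^ k) = b * q ^ m * p ^ k - c * q ^ k * p ^ m := by
    have : (u : ℝ) * (p ^ m * p ^ k) = b * q ^ m * p ^ k - c * q ^ k * p ^ m := by
      rw [← hm', ← hk']; ring
    exact_mod_cast this
  have h2 : (q : ℤ) ∣ u * (p ^ m * p ^ k) := by
    rw [h1]
    exact dvd_sub (((dvd_pow_self _ hm0).mul_left _).mul_right _)
      (((dvd_pow_self _ hk0).mul_left _).mul_right _)
  have h3 : (q : ℤ) ∣ u := by
    refine IsCoprime.dvd_of_dvd_mul_right ?_ h2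
    exact ((Nat.isCoprime_iff_coprime.2 hc.symm).pow_right).mul_right
      ((Nat.isCoprime_iff_coprime.2 hc.symm).pow_right)
  obtain ⟨r, hr, hrq, hrN⟩ := Nat.Prime.not_coprime_iff_dvd.1 hqN
  have h4 : (r : ℤ) ∣ u % N := by
    rw [Int.emod_def]
    exact dvd_sub ((Int.natCast_dvd_natCast.2 hrq).trans h3)
      ((Int.natCast_dvd_natCast.2 hrN).mul_right _)
  rw [hu] at h4
  exact (Nat.prime_iff_prime_int.1 hr).not_dvd_one (by exact_mod_cast h4)

lemma IsFull.integral (h : MaskSystem ρ N M F) (hN : 1 < N) (hρ : 0 < ρ)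
    (hK : ρ ∈ K) (hΛ : IsFull ρ N F K Λ x) (h0 : (0 : ℝ) ∈ Λ) {p q : ℕ} (hq : 1 < q)
    (hpq : ρ = p / q) (hc : p.Coprime q) : ∀ l ∈ Λ, ∃ z : ℤ, l = z :=
  hΛ.integral_of_not_coprime h hN hρ hK h0 hq hpq hc (hΛ.not_coprime h hN hρ hK h0 hq hpq hc)

lemma IsFull.dvd_denom (h : MaskSystem ρ N M F) (hN : 1 < N) (hρ : 0 < ρ)
    (hK : ρ ∈ K) (hΛ : IsFull ρ N F K Λ x) (h0 : (0 : ℝ) ∈ Λ) {p q : ℕ} (hq : 1 < q)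
    (hpq : ρ = p / q) (hc : p.Coprime q) : N ∣ q := by
  obtain ⟨l, hl, a, ha, hfl, hla⟩ := hΛ.exists_mem_selected h hN hρ hK h0
  obtain ⟨z, rfl⟩ := hΛ.integral h hN hρ hK h0 hq hpq hc l hl
  have hla' := (rat_mul_pow (by omega) hpq z 1 a).1 (by rwa [pow_one])
  rw [pow_one, pow_one] at hla'
  rw [Int.floor_intCast] at hfl
  have h1 : z * p = a * q := by exact_mod_cast hla'
  have h2 : (N : ℤ) ∣ a * q := h1 ▸ (Int.dvd_of_emod_eq_zero hfl).mul_right _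
  have h3 : IsCoprime (N : ℤ) a :=
    ⟨-(a / N), 1, by have := Int.emod_add_mul_ediv a N; rw [ha] at this; linarith⟩
  exact Int.natCast_dvd_natCast.1 (h3.dvd_of_dvd_mul_left h2)

end

section

variable {ρ : ℝ} {N : ℕ} {M F : ℝ → ℝ≥0} {K : Subfield ℝ} {Λ : Set ℝ} {x : ℝ} {p q : ℕ}

lemma MaskSystem.mask_le_one (h : MaskSystem ρ N M F) (hN : 0 < N) (t : ℝ) : M t ≤ 1 := by
  have h1 := h.sum_shift t
  have h2 := Finset.single_le_sum (f := fun i : ℕ => M (t + i)) (fun i _ => zero_le)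
    (Finset.mem_range.2 hN)
  rw [h1] at h2
  simpa using h2

lemma MaskSystem.le_one (h : MaskSystem ρ N M F) (t : ℝ) : F t ≤ 1 := by
  have h1 := h.bessel {0} (by
    intro l hl l' hl' hne
    exact absurd (hl.trans hl'.symm) hne) t
  rw [tsum_singleton (0 : ℝ) (fun l : ℝ => (F (t + l) : ℝ≥0∞)), add_zero] at h1
  exact_mod_cast h1

lemma MaskSystem.eq_prod_mul (h : MaskSystem ρ N M F) (n : ℕ) (t : ℝ) :
    F t = (∏ k ∈ Finset.range n, M (ρ ^ k * t)) * F (ρ ^ n * t) := by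
  induction n with
  | zero => simp
  | succ n ih =>
    rw [Finset.prod_range_succ, ih, h.scale (ρ ^ n * t), ← mul_assoc, ← mul_assoc ρ, ← pow_succ']

lemma MaskSystem.prod_le_one (h : MaskSystem ρ N M F) (hN : 0 < N) (n : ℕ) (t : ℝ) :
    ∏ k ∈ Finset.range n, M (ρ ^ k * t) ≤ 1 :=
  Finset.prod_le_one' fun _ _ => h.mask_le_one hN _

lemma MaskSystem.le_scaled (h : MaskSystem ρ N M F) (hN : 0 < N) (n : ℕ) (t : ℝ) :
    F t ≤ F (ρ ^ n * t) := by
  rw [h.eq_prod_mul n t]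
  exact mul_le_of_le_one_left' (h.prod_le_one hN n t)

lemma MaskSystem.le_prod (h : MaskSystem ρ N M F) (n : ℕ) (t : ℝ) :
    F t ≤ ∏ k ∈ Finset.range n, M (ρ ^ k * t) := by
  rw [h.eq_prod_mul n t]
  exact mul_le_of_le_one_right' (h.le_one _)

/-- The Bessel inequality for finite products of masks. -/
lemma MaskSystem.sum_prod_le (h : MaskSystem ρ N M F) (hN : 0 < N) (hq : 0 < q)
    (hpq : ρ = p / q) (hp : 0 < p) (hpN : IsCoprime (N : ℤ) p) (n : ℕ) :
    ∀ R : Finset ℤ, (∀ z ∈ R, ∀ z' ∈ R, z ≠ z' →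
        ∃ k < n, ∃ a : ℤ, ¬ (N : ℤ) ∣ a ∧ z - z' = q ^ k * a) →
      ∀ x : ℝ, ∑ z ∈ R, ∏ k ∈ Finset.range n, M (ρ ^ k * (x + z)) ≤ 1 := by
  classical
  induction n with
  | zero =>
    intro R hR x
    simp only [Finset.range_zero, Finset.prod_empty, Finset.sum_const, nsmul_eq_mul, mul_one]
    have : R.card ≤ 1 := Finset.card_le_one.2 fun z hz z' hz' => by
      by_contra hne
      obtain ⟨k, hk, -⟩ := hR z hz z' hz' hne
      omega
    exact_mod_cast this
  | succ n ih =>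
    intro R hR x
    have hN' : (0 : ℤ) < N := by exact_mod_cast hN
    have hmaps : ∀ z ∈ R, (z % (N : ℤ)).toNat ∈ Finset.range N := fun z _ => by
      have := Int.emod_lt_of_pos z hN'
      have := Int.emod_nonneg z hN'.ne'
      rw [Finset.mem_range]
      omega
    rw [← Finset.sum_fiberwise_of_maps_to hmaps, ← h.sum_shift x]
    refine Finset.sum_le_sum fun i hi => ?_
    set S := R.filter fun z => (z % (N : ℤ)).toNat = i with hS
    have hmod : ∀ z ∈ S, z % (N : ℤ) = i := fun z hz => by
      have h1 := (Finset.mem_filter.1 hz).2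
      have := Int.emod_nonneg z hN'.ne'
      omega
    have hMz : ∀ z ∈ S, M (x + z) = M (x + i) := fun z hz => by
      rw [← h.periodic_int (x + i) (z / N)]
      congr 1
      have h1 := Int.emod_add_mul_ediv z N
      rw [hmod z hz] at h1
      have h2 : (i : ℝ) + N * (z / N : ℤ) = z := by exact_mod_cast h1
      linarith
    rcases S.eq_empty_or_nonempty with he | ⟨z₀, hz₀⟩
    · rw [he]; simp
    have hdiff : ∀ z ∈ S, ∀ z' ∈ S, z ≠ z' →
        ∃ k < n, ∃ a : ℤ, ¬ (N : ℤ) ∣ a ∧ z - z' = q ^ (k + 1) * a := by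
      intro z hz z' hz' hne
      obtain ⟨k, hk, a, ha, hzz⟩ := hR z (Finset.mem_filter.1 hz).1 z'
        (Finset.mem_filter.1 hz').1 hne
      cases k with
      | zero =>
        rw [pow_zero, one_mul] at hzz
        exact absurd (hzz ▸ Int.ModEq.dvd
          ((hmod z' hz').trans (hmod z hz).symm : z' ≡ z [ZMOD N])) ha
      | succ k => exact ⟨k, by omega, a, ha, hzz⟩
    have hq' : (q : ℤ) ≠ 0 := by positivity
    have hqd : ∀ z ∈ S, (q : ℤ) ∣ z - z₀ := by
      intro z hz
      by_cases hne : z = z₀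
      · rw [hne, sub_self]; exact dvd_zero _
      · obtain ⟨k, -, a, -, hzz⟩ := hdiff z hz z₀ hz₀ hne
        rw [hzz]
        exact (dvd_pow_self _ k.succ_ne_zero).mul_right _
    have hp' : (p : ℤ) ≠ 0 := by positivity
    have hsub : ∀ z ∈ S, ∀ z' ∈ S,
        q * (p * ((z - z₀) / q) - p * ((z' - z₀) / q)) = (p : ℤ) * (z - z') := by
      intro z hz z' hz'
      have h1 := Int.ediv_mul_cancel (hqd z hz)
      have h2 := Int.ediv_mul_cancel (hqd z' hz')
      linear_combination (p : ℤ) * h1 - (p : ℤ) * h2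
    have hinj : ∀ z ∈ S, ∀ z' ∈ S,
        (p : ℤ) * ((z - z₀) / q) = p * ((z' - z₀) / q) → z = z' := by
      intro z hz z' hz' he
      have h1 := hsub z hz z' hz'
      rw [he, sub_self, mul_zero] at h1
      have := (mul_eq_zero.1 h1.symm).resolve_left hp'
      linarith
    have key := ih (S.image fun z => (p : ℤ) * ((z - z₀) / q)) (by
      intro w hw w' hw' hne
      obtain ⟨z, hz, rfl⟩ := Finset.mem_image.1 hw
      obtain ⟨z', hz', rfl⟩ := Finset.mem_image.1 hw'
      obtain ⟨k, hk, a, ha, hzz⟩ := hdiff z hz z' hz' (by rintro rfl; exact hne rfl)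
      refine ⟨k, hk, p * a, fun hd => ha (hpN.dvd_of_dvd_mul_left hd), ?_⟩
      apply mul_left_cancel₀ hq'
      rw [hsub z hz z' hz', hzz]
      ring) (ρ * (x + z₀))
    rw [Finset.sum_image hinj] at key
    calc ∑ z ∈ S, ∏ k ∈ Finset.range (n + 1), M (ρ ^ k * (x + z))
        = ∑ z ∈ S, M (x + i) * ∏ k ∈ Finset.range n,
            M (ρ ^ k * (ρ * (x + z₀) + ((p * ((z - z₀) / q) : ℤ) : ℝ))) := by
          refine Finset.sum_congr rfl fun z hz => ?_
          rw [Finset.prod_range_succ', pow_zero, one_mul, hMz z hz, mul_comm]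
          congr 1
          refine Finset.prod_congr rfl fun k _ => ?_
          congr 1
          have h1 : (((z - z₀) / q : ℤ) : ℝ) * q = z - z₀ := by
            exact_mod_cast Int.ediv_mul_cancel (hqd z hz)
          have h2 : ρ * (x + z) = ρ * (x + z₀) + ((p * ((z - z₀) / q) : ℤ) : ℝ) := by
            have : (z : ℝ) = z₀ + ((z - z₀) / q : ℤ) * q := by linarith
            have hq0 : (q : ℝ) ≠ 0 := by positivity
            rw [this, hpq]
            push_cast
            field_simp
            ring
          rw [← h2]
          ring
      _ ≤ M (x + i) := by
          rw [← Finset.mul_sum]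
          exact mul_le_of_le_one_right' key

/-- Some factor among the first `L + 1` is bounded away from `1`, since otherwise `t` would be
close to a nonzero multiple of `q ^ L`. -/
lemma MaskSystem.exists_mask_le (h : MaskSystem ρ N M F) (hN : 1 < N) (hpq : ρ = p / q)
    (hp : 0 < p) (hq : 0 < q) (hc : p.Coprime q) :
    ∃ θ < (1 : ℝ≥0), ∀ (L : ℕ) (t : ℝ), 1 ≤ |t| → |t| < q ^ L →
      ∃ k ≤ L, M (ρ ^ k * t) ≤ θ := by
  have hpR : (1 : ℝ) ≤ p := by exact_mod_cast hp
  have hqR : (1 : ℝ) ≤ q := by exact_mod_cast hq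
  have hNR : (2 : ℝ) ≤ N := by exact_mod_cast hN
  obtain ⟨θ, hθ, hgap⟩ := h.gap (1 / ((p : ℝ) + q)) (by positivity)
  refine ⟨θ, hθ, fun L t ht htL => ?_⟩
  by_contra! hcon
  have hδ : 1 / ((p : ℝ) + q) ≤ 1 / 2 := by
    apply one_div_le_one_div_of_le <;> linarith
  have hz : ∀ k ≤ L, ∃ z : ℤ, |ρ ^ k * t - N * z| < 1 / ((p : ℝ) + q) := by
    intro k hk
    by_contra! hz
    exact absurd (hgap _ hz) (not_le.2 (hcon k hk))
  choose! z hz using hz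
  have hrec : ∀ k < L, (p : ℤ) * z k = q * z (k + 1) := by
    intro k hk
    have h1 := hz k hk.le
    have h2 := hz (k + 1) hk
    have h3 : (q : ℝ) * (ρ ^ (k + 1) * t) = p * (ρ ^ k * t) := by
      rw [pow_succ, hpq]; field_simp
    have h4 : |(N : ℝ) * (p * z k - q * z (k + 1))| < 1 := by
      have : (N : ℝ) * (p * z k - q * z (k + 1)) = q * (ρ ^ (k + 1) * t - N * z (k + 1))
          - p * (ρ ^ k * t - N * z k) := by
        linear_combination -h3
      rw [this]
      refine (abs_sub _ _).trans_lt ?_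
      rw [abs_mul, abs_mul, abs_of_pos (by positivity : (0 : ℝ) < q),
        abs_of_pos (by positivity : (0 : ℝ) < p)]
      have : (q : ℝ) * (1 / (p + q)) + p * (1 / (p + q)) = 1 := by
        field_simp
        ring
      rw [← this]
      gcongr
    have h5 : |(p : ℝ) * z k - q * z (k + 1)| < 1 := by
      rw [abs_mul, abs_of_pos (by positivity : (0 : ℝ) < N)] at h4
      refine lt_of_le_of_lt ?_ h4
      exact le_mul_of_one_le_left (abs_nonneg _) (by linarith)
    have h6 : |(p : ℤ) * z k - q * z (k + 1)| < 1 := by exact_mod_cast h5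
    rw [Int.abs_lt_one_iff] at h6
    linarith
  have hpow : ∀ k ≤ L, (p : ℤ) ^ k * z 0 = q ^ k * z k := by
    intro k
    induction k with
    | zero => simp
    | succ k ih =>
      intro hk
      linear_combination (p : ℤ) * ih (by omega) + (q : ℤ) ^ k * hrec k (by omega)
  have hdvd : (q : ℤ) ^ L ∣ z 0 := by
    refine IsCoprime.dvd_of_dvd_mul_left (y := (p : ℤ) ^ L)
      (Nat.isCoprime_iff_coprime.2 hc.symm).pow ?_
    rw [hpow L le_rfl]
    exact dvd_mul_right _ _
  have h0 := hz 0 (Nat.zero_le _)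
  rw [pow_zero, one_mul] at h0
  have hz0 : z 0 ≠ 0 := by
    intro hz0
    rw [hz0] at h0
    simp only [Int.cast_zero, mul_zero, sub_zero] at h0
    linarith
  have h1 : (q : ℤ) ^ L ≤ |z 0| := Int.le_of_dvd (abs_pos.2 hz0) ((dvd_abs _ _).2 hdvd)
  have h2 : (q : ℝ) ^ L ≤ |(z 0 : ℝ)| := by exact_mod_cast h1
  have h3 : (1 : ℝ) ≤ |(z 0 : ℝ)| := by exact_mod_cast Int.one_le_abs hz0
  have h4 : 2 * |(z 0 : ℝ)| ≤ |(N : ℝ) * z 0| := by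
    rw [abs_mul, abs_of_pos (by positivity : (0 : ℝ) < N)]
    gcongr
  have h5 := abs_sub_abs_le_abs_sub ((N : ℝ) * z 0) t
  rw [abs_sub_comm] at h5
  linarith

/-- The transform decays: the `j`-th scale costs `j` factors bounded away from `1`. -/
lemma MaskSystem.exists_decay (h : MaskSystem ρ N M F) (hN : 1 < N) (hρ0 : 0 < ρ) (hρ1 : ρ < 1)
    (hpq : ρ = p / q) (hp : 1 < p) (hq : 0 < q) (hc : p.Coprime q) :
    ∃ θ < (1 : ℝ≥0), ∀ (j : ℕ) (t : ℝ), 1 ≤ ρ ^ (3 * q) ^ j * |t| → F t ≤ θ ^ j := by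
  have hN0 : 0 < N := by omega
  obtain ⟨θ, hθ, hM⟩ := h.exists_mask_le hN hpq (by omega) hq hc
  have hpR : (0 : ℝ) < p := by positivity
  have hqR : (1 : ℝ) ≤ q := by exact_mod_cast hq
  have hqp : (q : ℝ) ≤ p ^ q := by
    have : q ≤ p ^ q := (Nat.lt_pow_self hp).le
    exact_mod_cast this
  refine ⟨θ, hθ, fun j => ?_⟩
  induction j with
  | zero => intro t _; simpa using h.le_one t
  | succ j ih =>
    have near : ∀ t : ℝ, 1 ≤ ρ ^ (3 * q) ^ (j + 1) * |t| → ρ ^ (3 * q) ^ (j + 1) * |t| * ρ < 1 →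
        F t ≤ θ ^ (j + 1) := by
      intro t h1 h2
      set l := (3 * q) ^ j with hl
      have hl1 : 1 ≤ l := Nat.one_le_pow _ _ (by omega)
      have hr : (3 * q) ^ (j + 1) = 3 * q * l := by rw [pow_succ, mul_comm]
      rw [hr] at h1 h2
      have hql : l ≤ q * l := Nat.le_mul_of_pos_left _ hq
      obtain ⟨L, hL⟩ : ∃ L, L + l + 1 = 3 * q * l :=
        ⟨3 * q * l - l - 1, by have : 3 * q * l = 3 * (q * l) := by ring
                               omega⟩
      have ht1 : 1 ≤ |t| := h1.trans (mul_le_of_le_one_left (abs_nonneg _)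
        (pow_le_one₀ hρ0.le hρ1.le))
      have htL : |t| < q ^ L := by
        have e1 : (q : ℝ) ^ (l + 2) ≤ p ^ (3 * q * l + 1) := by
          calc (q : ℝ) ^ (l + 2) ≤ (p ^ q) ^ (l + 2) := by gcongr
            _ = p ^ (q * (l + 2)) := (pow_mul _ _ _).symm
            _ ≤ p ^ (3 * q * l + 1) := by
              refine pow_le_pow_right₀ (by exact_mod_cast hp.le) ?_
              nlinarith
        have e2 : ρ * q = p := by rw [hpq]; field_simp
        have e3 : |t| * p ^ (3 * q * l + 1) < q ^ L * q ^ (l + 2) := by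
          have : |t| * p ^ (3 * q * l + 1) =
              ρ ^ (3 * q * l) * |t| * ρ * (q ^ L * q ^ (l + 2)) := by
            rw [← e2, mul_pow, ← pow_add, show L + (l + 2) = 3 * q * l + 1 by omega, pow_succ ρ]
            ring
          rw [this]
          exact mul_lt_of_lt_one_left (by positivity) h2
        have e4 : |t| * p ^ (3 * q * l + 1) < q ^ L * p ^ (3 * q * l + 1) :=
          e3.trans_le (by gcongr)
        exact lt_of_mul_lt_mul_right e4 (by positivity)
      obtain ⟨k, hk, hMk⟩ := hM L t ht1 htL
      have hnext : F (ρ ^ (k + 1) * t) ≤ θ ^ j := by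
        refine ih _ (h1.trans ?_)
        rw [abs_mul, abs_of_pos (pow_pos hρ0 _), ← mul_assoc, ← pow_add]
        gcongr ?_ * _
        exact pow_le_pow_of_le_one hρ0.le hρ1.le (by omega)
      calc F t ≤ F (ρ ^ k * t) := h.le_scaled hN0 k t
        _ = M (ρ ^ k * t) * F (ρ ^ (k + 1) * t) := by rw [h.scale, ← mul_assoc, ← pow_succ']
        _ ≤ θ * θ ^ j := mul_le_mul' hMk hnext
        _ = θ ^ (j + 1) := (pow_succ' _ _).symm
    intro t ht
    obtain ⟨m, hm1, hm2⟩ := exists_nat_pow_near_of_lt_one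
      (x := (ρ ^ (3 * q) ^ (j + 1) * |t|)⁻¹) (by positivity) (inv_le_one_of_one_le₀ ht) hρ0 hρ1
    refine (h.le_scaled hN0 m t).trans (near _ ?_ ?_)
    · rw [abs_mul, abs_of_pos (pow_pos hρ0 _)]
      rw [inv_le_iff_one_le_mul₀ (by positivity)] at hm2
      linarith
    · rw [abs_mul, abs_of_pos (pow_pos hρ0 _)]
      have hA : 0 < ρ ^ (3 * q) ^ (j + 1) * |t| := by linarith
      have := mul_lt_mul_of_pos_right hm1 hA
      rw [inv_mul_cancel₀ hA.ne', pow_succ] at this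
      linarith

lemma exists_pos_le_of_contraction {u : ℕ → ℝ} {θ H : ℝ} (hθ0 : 0 ≤ θ) (hθ1 : θ < 1)
    (hH : 0 ≤ H) (hu : Antitone u) (hpos : ∀ j, 0 < u j)
    (hstep : ∀ j, (1 - H * θ ^ j) * u j ≤ u (j + 1)) : ∃ c > 0, ∀ j, c ≤ u j := by
  have h1 : Filter.Tendsto (fun j => H * (1 - θ)⁻¹ * θ ^ j) Filter.atTop (nhds 0) := by
    have := (tendsto_pow_atTop_nhds_zero_of_lt_one hθ0 hθ1).const_mul (H * (1 - θ)⁻¹)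
    rwa [mul_zero] at this
  obtain ⟨J, hJ⟩ := (h1.eventually (gt_mem_nhds (by norm_num : (0 : ℝ) < 1 / 2))).exists
  have key : ∀ m, u J * (1 - H * θ ^ J * ∑ i ∈ Finset.range m, θ ^ i) ≤ u (J + m) := by
    intro m
    induction m with
    | zero => simp
    | succ m ih =>
      have h2 := hstep (J + m)
      have h3 : H * θ ^ (J + m) * u (J + m) ≤ H * θ ^ (J + m) * u J := by
        gcongr
        exact hu (Nat.le_add_right _ _)
      rw [Finset.sum_range_succ]
      rw [pow_add] at h2 h3
      rw [← add_assoc]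
      linarith
  have hlow : ∀ m, u J * (1 / 2) ≤ u (J + m) := by
    intro m
    refine le_trans ?_ (key m)
    have h4 : ∑ i ∈ Finset.range m, θ ^ i ≤ (1 - θ)⁻¹ := by
      rw [← tsum_geometric_of_lt_one hθ0 hθ1]
      exact (summable_geometric_of_lt_one hθ0 hθ1).sum_le_tsum _ fun i _ => by positivity
    have h5 : H * θ ^ J * ∑ i ∈ Finset.range m, θ ^ i ≤ H * θ ^ J * (1 - θ)⁻¹ := by gcongr
    have := hpos J
    gcongr
    linarith
  refine ⟨u J * (1 / 2), by have := hpos J; positivity, fun j => ?_⟩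
  exact (hlow j).trans (hu (Nat.le_add_left _ _))

/-- The elements of `Λ` among the integers of modulus less than `q ^ n / 2`. -/
noncomputable def truncated (q : ℕ) (Λ : Set ℝ) (n : ℕ) : Finset ℤ := by
  classical
  exact (Finset.Ioo (-(q : ℤ) ^ n) (q ^ n)).filter fun z => (z : ℝ) ∈ Λ ∧ 2 * |z| < q ^ n

lemma mem_truncated {n : ℕ} {z : ℤ} :
    z ∈ truncated q Λ n ↔ (z : ℝ) ∈ Λ ∧ 2 * |z| < (q : ℤ) ^ n := by
  classical
  simp only [truncated, Finset.mem_filter, Finset.mem_Ioo]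
  refine ⟨fun h => h.2, fun h => ⟨?_, h⟩⟩
  rw [← abs_lt]
  have := abs_nonneg z
  linarith [h.2]

lemma truncated_mono (hq : 0 < q) : Monotone (truncated q Λ) := by
  intro n m hnm z hz
  rw [mem_truncated] at hz ⊢
  exact ⟨hz.1, hz.2.trans_le (pow_le_pow_right₀ (by exact_mod_cast hq) hnm)⟩

lemma IsFull.sub_eq_of_int (hΛ : IsFull ρ N F K Λ x) (hq : 0 < q) (hpq : ρ = p / q)
    (hp : 0 < p) (hc : p.Coprime q) {z z' : ℤ} (hz : (z : ℝ) ∈ Λ)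
    (hz' : (z' : ℝ) ∈ Λ) (hne : z ≠ z') :
    ∃ k : ℕ, ∃ a : ℤ, ¬ (N : ℤ) ∣ a ∧ z - z' = q ^ k * a := by
  obtain ⟨k, a, ha, h1⟩ := hΛ.bizero z hz z' hz' (by exact_mod_cast hne)
  have h2 := (rat_mul_pow hq hpq _ k a).1 h1
  have h3 : (z - z') * (p : ℤ) ^ k = a * q ^ k := by exact_mod_cast h2
  have hcop : IsCoprime ((p : ℤ) ^ k) (q ^ k) := (Nat.isCoprime_iff_coprime.2 hc).pow
  obtain ⟨b, rfl⟩ := hcop.dvd_of_dvd_mul_right (h3 ▸ dvd_mul_left _ _ : (p : ℤ) ^ k ∣ a * q ^ k)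
  refine ⟨k, b, fun hd => ha (hd.mul_left _), ?_⟩
  apply mul_right_cancel₀ (pow_ne_zero k (by positivity : (p : ℤ) ≠ 0))
  rw [h3]
  ring

lemma IsFull.sub_eq_of_mem_truncated (hΛ : IsFull ρ N F K Λ x) (hq : 0 < q) (hpq : ρ = p / q)
    (hp : 0 < p) (hc : p.Coprime q) {n : ℕ} {z z' : ℤ} (hz : z ∈ truncated q Λ n)
    (hz' : z' ∈ truncated q Λ n) (hne : z ≠ z') :
    ∃ k < n, ∃ a : ℤ, ¬ (N : ℤ) ∣ a ∧ z - z' = q ^ k * a := by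
  rw [mem_truncated] at hz hz'
  obtain ⟨k, a, ha, h⟩ := hΛ.sub_eq_of_int hq hpq hp hc hz.1 hz'.1 hne
  refine ⟨k, ?_, a, ha, h⟩
  have h1 := abs_sub z z'
  have h0 : a ≠ 0 := by
    rintro rfl
    exact ha (dvd_zero _)
  have h2 : (q : ℤ) ^ k ≤ |z - z'| := by
    rw [h, abs_mul, abs_of_pos (by positivity : (0 : ℤ) < q ^ k)]
    exact le_mul_of_one_le_right (by positivity) (Int.one_le_abs h0)
  have h3 : (q : ℤ) ^ k < q ^ n := by linarith [hz.2, hz'.2]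
  by_contra! hk
  exact absurd (pow_le_pow_right₀ (by exact_mod_cast hq) hk) (not_le.2 h3)

lemma IsFull.tsum_int (hΛ : IsFull ρ N F K Λ x) (h_int : ∀ l ∈ Λ, ∃ z : ℤ, l = z) :
    ∑' z : ((↑) ⁻¹' Λ : Set ℤ), (F (x + (z : ℤ)) : ℝ≥0∞) = 1 := by
  rw [← hΛ.sum_eq]
  let e : ((↑) ⁻¹' Λ : Set ℤ) ≃ Λ := Equiv.ofBijective (fun z => ⟨((z : ℤ) : ℝ), z.2⟩) (by
    constructor
    · intro z z' h
      have : ((z : ℤ) : ℝ) = (z' : ℤ) := congrArg Subtype.val h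
      exact Subtype.ext (by exact_mod_cast this)
    · rintro ⟨l, hl⟩
      obtain ⟨z, rfl⟩ := h_int l hl
      exact ⟨⟨z, hl⟩, rfl⟩)
  exact e.tsum_eq (fun l : Λ => (F (x + l) : ℝ≥0∞))

lemma IsFull.sum_int_le (hΛ : IsFull ρ N F K Λ x) (h_int : ∀ l ∈ Λ, ∃ z : ℤ, l = z)
    (R : Finset ℤ) (hR : ∀ z ∈ R, (z : ℝ) ∈ Λ) : ∑ z ∈ R, F (x + z) ≤ 1 := by
  classical
  have h1 := hΛ.tsum_int h_int
  have h2 := ENNReal.sum_le_tsum (f := fun z : ((↑) ⁻¹' Λ : Set ℤ) => (F (x + (z : ℤ)) : ℝ≥0∞))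
    (R.subtype (· ∈ ((↑) ⁻¹' Λ : Set ℤ)))
  rw [h1, Finset.sum_subtype_of_mem (p := (· ∈ ((↑) ⁻¹' Λ : Set ℤ)))
    (fun z : ℤ => (F (x + z) : ℝ≥0∞)) hR] at h2
  exact_mod_cast h2

/-- The mass captured up to the `m`-th scale misses at least a fixed proportion of what was missing
at the `n`-th scale. -/
lemma IsFull.contraction (h : MaskSystem ρ N M F) (hΛ : IsFull ρ N F K Λ x) (hN : 0 < N)
    (hq : 0 < q) (hpq : ρ = p / q) (hp : 0 < p) (hc : p.Coprime q) (hNq : N ∣ q)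
    (hx : |x| ≤ 1) {n m : ℕ} (hnm : n ≤ m) {ε : ℝ≥0}
    (hε : ∀ t : ℝ, ρ ^ m * ((q : ℝ) ^ n / 2 - 1) ≤ |t| → F t ≤ ε) :
    (1 - (ε : ℝ)) * (1 - ∑ z ∈ truncated q Λ n, (F (x + z) : ℝ)) ≤
      1 - ∑ z ∈ truncated q Λ m, (F (x + z) : ℝ) := by
  classical
  have hsub := truncated_mono (Λ := Λ) hq hnm
  have hρ : 0 < ρ := by rw [hpq]; positivity
  have hpN : IsCoprime (N : ℤ) p :=
    Nat.isCoprime_iff_coprime.2 (Nat.Coprime.coprime_dvd_left hNq hc.symm)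
  have h1 := h.sum_prod_le hN hq hpq hp hpN m (truncated q Λ m)
    (fun z hz z' hz' hne => hΛ.sub_eq_of_mem_truncated hq hpq hp hc hz hz' hne) x
  rw [← Finset.sum_sdiff hsub] at h1 ⊢
  have h2 : ∑ z ∈ truncated q Λ n, F (x + z) ≤
      ∑ z ∈ truncated q Λ n, ∏ k ∈ Finset.range m, M (ρ ^ k * (x + z)) :=
    Finset.sum_le_sum fun z _ => h.le_prod m _
  have h3 : ∑ z ∈ truncated q Λ m \ truncated q Λ n, F (x + z) ≤
      ε * ∑ z ∈ truncated q Λ m \ truncated q Λ n, ∏ k ∈ Finset.range m, M (ρ ^ k * (x + z)) := by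
    rw [Finset.mul_sum]
    refine Finset.sum_le_sum fun z hz => ?_
    rw [h.eq_prod_mul m, mul_comm]
    gcongr
    refine hε _ ?_
    rw [abs_mul, abs_of_pos (pow_pos hρ m)]
    gcongr
    rw [Finset.mem_sdiff, mem_truncated, mem_truncated] at hz
    have h4 : (q : ℤ) ^ n ≤ 2 * |z| := by
      by_contra! h4
      exact hz.2 ⟨hz.1.1, h4⟩
    have h5 : (q : ℝ) ^ n ≤ 2 * |(z : ℝ)| := by exact_mod_cast h4
    have h6 := abs_sub_abs_le_abs_sub (z : ℝ) (-x)
    rw [abs_neg, sub_neg_eq_add, add_comm (z : ℝ)] at h6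
    linarith
  have h1' : ((∑ z ∈ truncated q Λ m \ truncated q Λ n, ∏ k ∈ Finset.range m,
      M (ρ ^ k * (x + z)) : ℝ≥0) : ℝ) + ((∑ z ∈ truncated q Λ n, ∏ k ∈ Finset.range m,
      M (ρ ^ k * (x + z)) : ℝ≥0) : ℝ) ≤ 1 := by exact_mod_cast h1
  have h2' := NNReal.coe_le_coe.2 h2
  have h3' := NNReal.coe_le_coe.2 h3
  rw [NNReal.coe_mul] at h3'
  have h7 : ((∑ z ∈ truncated q Λ m \ truncated q Λ n, F (x + z) : ℝ≥0) : ℝ) ≤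
      ε * (1 - ((∑ z ∈ truncated q Λ n, F (x + z) : ℝ≥0) : ℝ)) :=
    h3'.trans (by gcongr; linarith)
  simp only [NNReal.coe_sum] at h7
  linarith

lemma IsFull.sum_truncated_lt_one (h : MaskSystem ρ N M F) (hΛ : IsFull ρ N F K Λ x) (hN : 1 < N)
    (hK : ρ ∈ K) (h0 : (0 : ℝ) ∈ Λ) (hq : 1 < q) (hpq : ρ = p / q) (hp : 0 < p)
    (hc : p.Coprime q) (n : ℕ) : ∑ z ∈ truncated q Λ n, (F (x + z) : ℝ) < 1 := by
  have hρ : 0 < ρ := by rw [hpq]; positivity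
  have h_int := hΛ.integral h hN hρ hK h0 hq hpq hc
  obtain ⟨l, hl, a, ha, hla⟩ := IsFull.exists_mem_pow h hN hρ hK n Λ x hΛ h0
  obtain ⟨z, rfl⟩ := h_int l hl
  have h1 := (rat_mul_pow (by omega) hpq _ n a).1 hla
  have h2 : z * (p : ℤ) ^ n = a * q ^ n := by exact_mod_cast h1
  have hcop : IsCoprime ((q : ℤ) ^ n) (p ^ n) := (Nat.isCoprime_iff_coprime.2 hc.symm).pow
  have hd : (q : ℤ) ^ n ∣ z := hcop.dvd_of_dvd_mul_right (h2 ▸ dvd_mul_left _ _)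
  have hz0 : z ≠ 0 := by
    rintro rfl
    rw [zero_mul] at h2
    have ha0 : a = 0 := (mul_eq_zero.1 h2.symm).resolve_right (by positivity)
    rw [ha0] at ha
    simp at ha
  have hz1 : (q : ℤ) ^ n ≤ |z| := Int.le_of_dvd (abs_pos.2 hz0) ((dvd_abs _ _).2 hd)
  have hzn : z ∉ truncated q Λ n := by
    rw [mem_truncated]
    rintro ⟨-, h3⟩
    have := abs_nonneg z
    linarith
  have h4 := hΛ.sum_int_le h_int (insert z (truncated q Λ n)) (by
    intro w hw
    rcases Finset.mem_insert.1 hw with rfl | hw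
    · exact hl
    · exact (mem_truncated.1 hw).1)
  rw [Finset.sum_insert hzn] at h4
  have h5 : F (x + z) ≠ 0 := h.ne_zero_of_notMem hρ hK fun hx => hΛ.gen (by
    have := sub_mem hx (intCast_mem K z)
    rwa [add_sub_cancel_right] at this)
  have h6 : (0 : ℝ) < F (x + z) := by exact_mod_cast pos_iff_ne_zero.2 h5
  have h7 : (F (x + z) : ℝ) + ∑ z ∈ truncated q Λ n, (F (x + z) : ℝ) ≤ 1 := by exact_mod_cast h4
  linarith

lemma IsFull.numerator_eq_one (h : MaskSystem ρ N M F) (hΛ : IsFull ρ N F K Λ x) (hN : 1 < N)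
    (hK : ρ ∈ K) (h0 : (0 : ℝ) ∈ Λ) (hx : |x| ≤ 1) (hp : 0 < p) (hpq' : p < q)
    (hpq : ρ = p / q) (hc : p.Coprime q) : p = 1 := by
  classical
  by_contra hp1
  have hp2 : 1 < p := by omega
  have hq : 1 < q := by omega
  have hρ : 0 < ρ := by rw [hpq]; positivity
  have hqR : (0 : ℝ) < q := by positivity
  have hρ1 : ρ < 1 := by
    rw [hpq, div_lt_one hqR]
    exact_mod_cast hpq'
  have h_int := hΛ.integral h hN hρ hK h0 hq hpq hc
  have hNq := hΛ.dvd_denom h hN hρ hK h0 hq hpq hc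
  obtain ⟨θ, hθ, hdecay⟩ := h.exists_decay hN hρ hρ1 hpq hp2 (by omega) hc
  have hθ' : (θ : ℝ) < 1 := by exact_mod_cast hθ
  set r := 3 * q with hr
  set y : ℕ → ℝ := fun n => 1 - ∑ z ∈ truncated q Λ n, (F (x + z) : ℝ) with hy
  have hy_anti : Antitone y := by
    intro n m hnm
    simp only [hy]
    gcongr
    exact truncated_mono (by omega) hnm
  have hy_pos : ∀ n, 0 < y n := fun n =>
    sub_pos.2 (hΛ.sum_truncated_lt_one h hN hK h0 hq hpq hp hc n)
  have hstep : ∀ j n, r ^ (j + 1) ≤ n → (1 - (θ : ℝ) ^ j) * y n ≤ y (n + r ^ j) := by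
    intro j n hn
    have := hΛ.contraction h (by omega) (by omega) hpq hp hc hNq hx
      (Nat.le_add_right n (r ^ j)) (ε := θ ^ j) (fun t ht => hdecay j t (le_trans ?_
        (mul_le_mul_of_nonneg_left ht (pow_pos hρ _).le)))
    · simpa only [NNReal.coe_pow] using this
    · set l := r ^ j with hl
      have hl1 : 1 ≤ l := Nat.one_le_pow _ _ (by omega)
      rw [pow_succ, ← hl, mul_comm, hr] at hn
      have hql : 3 ≤ q * l := by nlinarith
      have e1 : (4 : ℝ) * q ^ (2 * l) ≤ p ^ (n + 2 * l) := by
        calc (4 : ℝ) * q ^ (2 * l) ≤ p ^ 2 * (p ^ q) ^ (2 * l) := by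
              have e2 : (2 : ℝ) ≤ p := by exact_mod_cast hp2
              have e3 : (q : ℝ) ≤ p ^ q := by exact_mod_cast (Nat.lt_pow_self hp2).le
              gcongr
              nlinarith
          _ = p ^ (2 + q * (2 * l)) := by rw [pow_add, pow_mul (p : ℝ) q (2 * l)]
          _ ≤ p ^ (n + 2 * l) := by
              refine pow_le_pow_right₀ (by exact_mod_cast hp2.le) ?_
              nlinarith
      have e4 : (4 : ℝ) ≤ q ^ n := by
        have e5 : (2 : ℝ) ≤ q := by exact_mod_cast hq
        calc (4 : ℝ) = 2 ^ 2 := by norm_num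
          _ ≤ q ^ 2 := by gcongr
          _ ≤ q ^ n := pow_le_pow_right₀ (by linarith) (by nlinarith)
      have e6 : ρ * q = p := by rw [hpq]; field_simp
      have e7 : 1 ≤ ρ ^ (n + 2 * l) * ((q : ℝ) ^ n / 4) := by
        have e8 : ρ ^ (n + 2 * l) * ((q : ℝ) ^ n / 4) * (4 * q ^ (2 * l)) = p ^ (n + 2 * l) := by
          rw [← e6, mul_pow, pow_add (q : ℝ)]
          ring
        rw [← e8] at e1
        exact le_of_mul_le_mul_right (by rwa [one_mul]) (by positivity : (0 : ℝ) < 4 * q ^ (2 * l))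
      rw [← mul_assoc, ← pow_add, show l + (n + l) = n + 2 * l by ring]
      refine e7.trans ?_
      gcongr
      linarith
  have hiter : ∀ j n i, r ^ (j + 1) ≤ n → (1 - (θ : ℝ) ^ j) ^ i * y n ≤ y (n + i * r ^ j) := by
    intro j n i hn
    have hθj : (θ : ℝ) ^ j ≤ 1 := pow_le_one₀ θ.2 hθ'.le
    induction i with
    | zero => simp
    | succ i ih =>
      rw [pow_succ', mul_assoc, add_mul, one_mul, ← add_assoc]
      exact (mul_le_mul_of_nonneg_left ih (sub_nonneg.2 hθj)).trans
        (hstep j _ (hn.trans (Nat.le_add_right _ _)))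
  have hrr : r ≤ r ^ 2 := Nat.le_self_pow two_ne_zero r
  obtain ⟨c, hc0, hcy⟩ := exists_pos_le_of_contraction (u := fun j => y (r ^ (j + 1)))
    (θ := θ) (H := (r ^ 2 - r : ℕ)) θ.2 hθ' (Nat.cast_nonneg _)
    (fun i j hij => hy_anti (Nat.pow_le_pow_right (by omega) (by omega)))
    (fun j => hy_pos _) (fun j => by
      have h1 := hiter j (r ^ (j + 1)) (r ^ 2 - r) le_rfl
      have h2 : r ^ (j + 1) + (r ^ 2 - r) * r ^ j = r ^ (j + 1 + 1) := by
        rw [Nat.sub_mul, ← Nat.add_sub_assoc (Nat.mul_le_mul_right _ hrr)]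
        rw [Nat.sub_eq_iff_eq_add ((Nat.mul_le_mul_right _ hrr).trans (Nat.le_add_left _ _))]
        ring
      rw [h2] at h1
      refine le_trans ?_ h1
      have h3 : -2 ≤ -(θ : ℝ) ^ j := by
        have := pow_le_one₀ θ.2 hθ'.le (n := j)
        simp only [NNReal.val_eq_coe] at this
        linarith
      have h4 := one_add_mul_le_pow h3 (r ^ 2 - r)
      have := (hy_pos (r ^ (j + 1))).le
      gcongr
      rw [← sub_eq_add_neg] at h4
      linarith)
  have hfin : ∀ R : Finset ((↑) ⁻¹' Λ : Set ℤ), ∑ z ∈ R, (F (x + (z : ℤ)) : ℝ) ≤ 1 - c := by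
    intro R
    obtain ⟨j, hj⟩ : ∃ j, R.map (Function.Embedding.subtype _) ⊆ truncated q Λ (r ^ (j + 1)) := by
      obtain ⟨B, hB⟩ := (R.image fun z : ((↑) ⁻¹' Λ : Set ℤ) => (|(z : ℤ)|).toNat).exists_le
      refine ⟨2 * B, fun z hz => ?_⟩
      obtain ⟨w, hw, rfl⟩ := Finset.mem_map.1 hz
      rw [mem_truncated]
      refine ⟨w.2, ?_⟩
      have h1 := hB _ (Finset.mem_image_of_mem _ hw)
      have h2 : 2 * B < q ^ r ^ (2 * B + 1) :=
        (Nat.lt_succ_self _).trans ((Nat.lt_pow_self (by omega : 1 < r)).trans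
          (Nat.lt_pow_self hq))
      have h3 : ((2 * B : ℕ) : ℤ) < (q : ℤ) ^ r ^ (2 * B + 1) := by exact_mod_cast h2
      have := abs_nonneg (w : ℤ)
      simp only [Function.Embedding.subtype_apply]
      push_cast at h3
      omega
    have h1 := hcy j
    simp only [hy] at h1
    have h2 : ∑ z ∈ R, (F (x + (z : ℤ)) : ℝ) ≤
        ∑ z ∈ truncated q Λ (r ^ (j + 1)), (F (x + z) : ℝ) := by
      refine (Finset.sum_map R (Function.Embedding.subtype _)
        (fun z : ℤ => (F (x + z) : ℝ))).symm.trans_le ?_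
      exact Finset.sum_le_sum_of_subset_of_nonneg hj fun _ _ _ => NNReal.coe_nonneg _
    linarith
  have h1 := hΛ.tsum_int h_int
  have h2 : ∑' z : ((↑) ⁻¹' Λ : Set ℤ), (F (x + (z : ℤ)) : ℝ≥0∞) ≤ ENNReal.ofReal (1 - c) := by
    rw [ENNReal.tsum_eq_iSup_sum]
    refine iSup_le fun R => ?_
    have h3 := ENNReal.ofReal_le_ofReal (hfin R)
    rwa [ENNReal.ofReal_sum_of_nonneg fun _ _ => NNReal.coe_nonneg _,
      Finset.sum_congr rfl fun z _ => ENNReal.ofReal_coe_nnreal] at h3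
  rw [h1, ← ENNReal.ofReal_one] at h2
  rw [ENNReal.ofReal_le_ofReal_iff'] at h2
  rcases h2 with h2 | h2 <;> linarith

end

section

variable {ρ : ℝ} {N : ℕ} {μ : Measure ℝ}

/-- The mask polynomial of the digit set `{0, …, N - 1}`. -/
noncomputable def mask (N : ℕ) (ξ : ℝ) : ℂ :=
  (N : ℂ)⁻¹ * ∑ j ∈ Finset.range N, cexp (-2 * π * I * ξ * j)

lemma mask_continuous : Continuous (mask N) := by
  unfold mask
  fun_prop

lemma mask_eq_zero_of_int (hN : 0 < N) {ξ : ℝ} {a : ℤ} (ha : ¬ (N : ℤ) ∣ a)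
    (h : N * ξ = a) : mask N ξ = 0 := by
  have hNC : (N : ℂ) ≠ 0 := by exact_mod_cast hN.ne'
  have h' : (N : ℂ) * ξ = a := by exact_mod_cast h
  have h1 : ∑ j ∈ Finset.range N, cexp (-2 * π * I * ξ * j) =
      ∑ j ∈ Finset.range N, cexp (-2 * π * I * ξ) ^ j :=
    Finset.sum_congr rfl fun j _ => by rw [← Complex.exp_nat_mul, mul_comm]
  have hw : cexp (-2 * π * I * ξ) ≠ 1 := by
    rw [Ne, Complex.exp_eq_one_iff]
    rintro ⟨n, hn⟩
    have h2 : (ξ : ℂ) = -n := by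
      have : (2 * π * I : ℂ) ≠ 0 := Complex.two_pi_I_ne_zero
      apply mul_left_cancel₀ this
      linear_combination -hn
    rw [h2] at h'
    refine ha ⟨-n, ?_⟩
    have h3 : ((N * -n : ℤ) : ℂ) = a := by push_cast; exact h'
    exact_mod_cast h3.symm
  have hwN : cexp (-2 * π * I * ξ) ^ N = 1 := by
    rw [← Complex.exp_nat_mul, Complex.exp_eq_one_iff]
    exact ⟨-a, by push_cast; linear_combination (-2 * π * I) * h'⟩
  unfold mask
  rw [h1, geom_sum_eq hw, hwN]
  simp

lemma mask_eq_zero (hN : 0 < N) {ξ : ℝ} (h : mask N ξ = 0) :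
    ∃ a : ℤ, ¬ (N : ℤ) ∣ a ∧ N * ξ = a := by
  have hNC : (N : ℂ) ≠ 0 := by exact_mod_cast hN.ne'
  have h1 : ∑ j ∈ Finset.range N, cexp (-2 * π * I * ξ * j) =
      ∑ j ∈ Finset.range N, cexp (-2 * π * I * ξ) ^ j :=
    Finset.sum_congr rfl fun j _ => by rw [← Complex.exp_nat_mul, mul_comm]
  unfold mask at h
  rw [h1] at h
  have h2 := (mul_eq_zero.1 h).resolve_left (inv_ne_zero hNC)
  have hw : cexp (-2 * π * I * ξ) ≠ 1 := by
    intro hw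
    rw [hw] at h2
    simp at h2
    omega
  rw [geom_sum_eq hw, div_eq_zero_iff] at h2
  have h3 := h2.resolve_right (sub_ne_zero.2 hw)
  rw [sub_eq_zero, ← Complex.exp_nat_mul, Complex.exp_eq_one_iff] at h3
  obtain ⟨n, hn⟩ := h3
  have h4 : (N : ℂ) * ξ = -n := by
    have : (2 * π * I : ℂ) ≠ 0 := Complex.two_pi_I_ne_zero
    apply mul_left_cancel₀ this
    linear_combination -hn
  refine ⟨-n, ?_, by push_cast; exact_mod_cast h4⟩
  rintro ⟨b, hb⟩
  apply hw
  rw [Complex.exp_eq_one_iff]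
  refine ⟨-b, ?_⟩
  have h5 : (-n : ℂ) = N * b := by exact_mod_cast congrArg (Int.cast : ℤ → ℂ) hb
  have h6 : (ξ : ℂ) = b := mul_left_cancel₀ hNC (h4.trans h5)
  rw [h6]
  push_cast
  ring

lemma mask_add_one (ξ : ℝ) : mask N (ξ + 1) = mask N ξ := by
  unfold mask
  congr 1
  refine Finset.sum_congr rfl fun j _ => ?_
  rw [Complex.exp_eq_exp_iff_exists_int]
  exact ⟨-j, by push_cast; ring⟩

lemma sum_normSq_mask (hN : 0 < N) (t : ℝ) :
    ∑ i ∈ Finset.range N, ‖mask N ((t + i) / N)‖ ^ 2 = 1 := by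
  have hNC : (N : ℂ) ≠ 0 := by exact_mod_cast hN.ne'
  have h0 : ∀ ξ : ℝ, ((‖mask N ξ‖ ^ 2 : ℝ) : ℂ) = (N : ℂ)⁻¹ ^ 2 * ∑ j ∈ Finset.range N,
      ∑ k ∈ Finset.range N, cexp (-2 * π * I * ξ * (j - k)) := by
    intro ξ
    rw [Complex.ofReal_pow, ← Complex.mul_conj', mask, map_mul, map_sum, map_inv₀,
      Complex.conj_natCast,
      mul_mul_mul_comm, Finset.sum_mul_sum, sq]
    congr 1
    refine Finset.sum_congr rfl fun j _ => Finset.sum_congr rfl fun k _ => ?_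
    rw [← Complex.exp_conj, ← Complex.exp_add]
    congr 1
    simp [Complex.conj_ofNat]
    ring
  have h1 : ∀ j ∈ Finset.range N, ∀ k ∈ Finset.range N,
      ∑ i ∈ Finset.range N, cexp (-2 * π * I * (((t + i) / N : ℝ) : ℂ) * (j - k)) =
        if j = k then (N : ℂ) else 0 := by
    intro j hj k hk
    split_ifs with hjk
    · simp [hjk]
    · have h2 : mask N (((j : ℝ) - k) / N) = 0 := by
        refine mask_eq_zero_of_int hN (a := j - k) ?_ (by push_cast; field_simp)
        intro hd
        rw [Finset.mem_range] at hj hk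
        have := Int.eq_zero_of_abs_lt_dvd hd (by rw [abs_lt]; omega)
        omega
      have h3 := (mul_eq_zero.1 h2).resolve_left (inv_ne_zero hNC)
      calc _ = ∑ i ∈ Finset.range N, cexp (-2 * π * I * (t / N) * (j - k)) *
            cexp (-2 * π * I * ((((j : ℝ) - k) / N : ℝ) : ℂ) * i) := by
              refine Finset.sum_congr rfl fun i _ => ?_
              rw [← Complex.exp_add]
              congr 1
              push_cast
              ring
        _ = 0 := by rw [← Finset.mul_sum, h3, mul_zero]
  have h4 : ((∑ i ∈ Finset.range N, ‖mask N ((t + i) / N)‖ ^ 2 : ℝ) : ℂ) = 1 := by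
    rw [Complex.ofReal_sum, Finset.sum_congr rfl fun i _ => h0 _, ← Finset.mul_sum,
      Finset.sum_comm, Finset.sum_congr rfl fun j _ => Finset.sum_comm,
      Finset.sum_congr rfl fun j hj => Finset.sum_congr rfl fun k hk => h1 j hj k hk]
    simp only [Finset.sum_ite_eq, Finset.mem_range]
    rw [Finset.sum_congr rfl fun j hj => if_pos (Finset.mem_range.1 hj)]
    simp
    field_simp
  exact_mod_cast h4

lemma FT_eq_charFun (ξ : ℝ) : FT μ ξ = charFun μ (-2 * π * ξ) := by
  unfold FT
  rw [charFun_apply_real]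
  refine integral_congr_ae (.of_forall fun x => ?_)
  simp only
  congr 1
  push_cast
  ring

lemma FT_continuous [IsProbabilityMeasure μ] : Continuous (FT μ) := by
  have : FT μ = fun ξ => charFun μ (-2 * π * ξ) := funext FT_eq_charFun
  rw [this]
  exact continuous_charFun.comp (by fun_prop)

lemma FT_zero [IsProbabilityMeasure μ] : FT μ 0 = 1 := by simp [FT]

lemma norm_exp_char (ξ x : ℝ) : ‖cexp (-2 * π * I * ξ * x)‖ = 1 := by
  rw [show -2 * π * I * ξ * x = ((-2 * π * ξ * x : ℝ) : ℂ) * I by push_cast; ring]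
  exact Complex.norm_exp_ofReal_mul_I _

lemma IsSelfSimilar.FT_eq [IsProbabilityMeasure μ] (hμ : IsSelfSimilar ρ N μ) (ξ : ℝ) :
    FT μ ξ = mask N ξ * FT μ (ρ * ξ) := by
  have h_int : ∀ j ∈ Finset.range N, Integrable (fun x : ℝ => cexp (-2 * π * I * ξ * x))
      (μ.map (fun x => ρ * x + (j : ℝ))) := by
    intro j _
    have : IsProbabilityMeasure (μ.map (fun x => ρ * x + (j : ℝ))) :=
      Measure.isProbabilityMeasure_map (by fun_prop)
    exact Integrable.of_bound (by fun_prop) 1 (.of_forall fun x => (norm_exp_char ξ x).le)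
  calc FT μ ξ = ∫ x, cexp (-2 * π * I * ξ * x)
        ∂((N : ℝ≥0∞)⁻¹ • ∑ j ∈ Finset.range N, μ.map (fun x => ρ * x + (j : ℝ))) := by
        rw [← show μ = _ from hμ]; rfl
    _ = (N : ℂ)⁻¹ * ∑ j ∈ Finset.range N, ∫ x : ℝ,
          cexp (-2 * π * I * ξ * ((ρ * x + j : ℝ) : ℂ)) ∂μ := by
        rw [integral_smul_measure, integral_finsetSum_measure h_int]
        simp only [ENNReal.toReal_inv, ENNReal.toReal_natCast, Complex.real_smul]
        push_cast
        congr 1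
        refine Finset.sum_congr rfl fun j _ => ?_
        rw [integral_map (by fun_prop) (by fun_prop)]
        push_cast
        rfl
    _ = mask N ξ * FT μ (ρ * ξ) := by
        unfold mask FT
        rw [mul_assoc (N : ℂ)⁻¹, Finset.sum_mul]
        congr 1
        refine Finset.sum_congr rfl fun j _ => ?_
        rw [← integral_const_mul]
        refine integral_congr_ae (.of_forall fun x => ?_)
        simp only
        rw [← Complex.exp_add]
        congr 1
        push_cast
        ring

lemma IsSelfSimilar.FT_eq_prod [IsProbabilityMeasure μ] (hμ : IsSelfSimilar ρ N μ) (ξ : ℝ)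
    (n : ℕ) : FT μ ξ = (∏ k ∈ Finset.range n, mask N (ρ ^ k * ξ)) * FT μ (ρ ^ n * ξ) := by
  induction n with
  | zero => simp
  | succ n ih =>
    rw [Finset.prod_range_succ, ih, hμ.FT_eq (ρ ^ n * ξ), ← mul_assoc, ← mul_assoc ρ, ← pow_succ']

lemma IsSelfSimilar.FT_eq_zero_of_mem [IsProbabilityMeasure μ] (hμ : IsSelfSimilar ρ N μ)
    (hN : 0 < N) {t : ℝ} (ht : t ∈ zeroSet ρ N) : FT μ (t / N) = 0 := by
  obtain ⟨n, a, ha, h⟩ := ht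
  have hNR : (N : ℝ) ≠ 0 := by positivity
  rw [hμ.FT_eq_prod _ (n + 1), Finset.prod_range_succ,
    mask_eq_zero_of_int hN ha (by rw [← h]; field_simp), mul_zero, zero_mul]

lemma IsSelfSimilar.mem_zeroSet [IsProbabilityMeasure μ] (hμ : IsSelfSimilar ρ N μ)
    (hρ0 : 0 < ρ) (hρ1 : ρ < 1) (hN : 0 < N) {t : ℝ} (ht : FT μ (t / N) = 0) :
    t ∈ zeroSet ρ N := by
  have hNR : (N : ℝ) ≠ 0 := by positivity
  have h1 : Filter.Tendsto (fun n : ℕ => FT μ (ρ ^ n * (t / N))) Filter.atTop (nhds 1) := by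
    rw [← FT_zero (μ := μ)]
    refine FT_continuous.continuousAt.tendsto.comp ?_
    have := (tendsto_pow_atTop_nhds_zero_of_lt_one hρ0.le hρ1).mul_const (t / N)
    rwa [zero_mul] at this
  obtain ⟨n, hn⟩ := (h1.eventually_ne one_ne_zero).exists
  rw [hμ.FT_eq_prod _ n] at ht
  obtain ⟨k, -, hk⟩ := Finset.prod_eq_zero_iff.1 ((mul_eq_zero.1 ht).resolve_right hn)
  obtain ⟨a, ha, h⟩ := mask_eq_zero hN hk
  exact ⟨k, a, ha, by rw [← h]; field_simp⟩

/-- The exponential `x ↦ e^{-2πiξx}` as an element of `L²(μ)`. -/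
noncomputable def expLp (μ : Measure ℝ) [IsProbabilityMeasure μ] (ξ : ℝ) : Lp ℂ 2 μ :=
  MemLp.toLp (fun x : ℝ => cexp (-2 * π * I * ξ * x))
    (MemLp.of_bound (by fun_prop) 1 (.of_forall fun x => (norm_exp_char ξ x).le))

lemma expLp_coeFn [IsProbabilityMeasure μ] (ξ : ℝ) :
    expLp μ ξ =ᵐ[μ] fun x : ℝ => cexp (-2 * π * I * ξ * x) := MemLp.coeFn_toLp _

lemma inner_expLp [IsProbabilityMeasure μ] (ξ : ℝ) (f : Lp ℂ 2 μ) :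
    inner ℂ (expLp μ ξ) f =
      ∫ x, f x * (starRingEnd ℂ) (cexp (-2 * π * I * ξ * x)) ∂μ := by
  rw [L2.inner_def]
  refine integral_congr_ae ?_
  filter_upwards [expLp_coeFn (μ := μ) ξ] with x hx
  rw [hx, RCLike.inner_apply]

lemma inner_expLp_expLp [IsProbabilityMeasure μ] (ξ ξ' : ℝ) :
    inner ℂ (expLp μ ξ) (expLp μ ξ') = FT μ (ξ' - ξ) := by
  rw [inner_expLp, FT]
  refine integral_congr_ae ?_
  filter_upwards [expLp_coeFn (μ := μ) ξ'] with x hx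
  rw [hx, ← Complex.exp_conj, ← Complex.exp_add]
  congr 1
  simp [Complex.conj_ofNat]
  ring

lemma norm_expLp [IsProbabilityMeasure μ] (ξ : ℝ) : ‖expLp μ ξ‖ = 1 := by
  have h := norm_sq_eq_re_inner (𝕜 := ℂ) (expLp μ ξ)
  rw [inner_expLp_expLp, sub_self, FT_zero, RCLike.one_re] at h
  exact (pow_eq_one_iff_of_nonneg (norm_nonneg _) two_ne_zero).1 h

end

section

variable {ρ : ℝ} {N : ℕ} {μ : Measure ℝ}

/-- The squared modulus of the mask polynomial, dilated by `N`. -/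
noncomputable def maskSq (N : ℕ) (t : ℝ) : ℝ≥0 := ‖mask N (t / N)‖₊ ^ 2

/-- The squared modulus of the Fourier transform, dilated by `N`. -/
noncomputable def ftSq (μ : Measure ℝ) (N : ℕ) (t : ℝ) : ℝ≥0 := ‖FT μ (t / N)‖₊ ^ 2

lemma maskSq_continuous : Continuous (maskSq N) :=
  (mask_continuous.comp (continuous_id.div_const _)).nnnorm.pow 2

lemma maskSq_add (hN : 0 < N) (t : ℝ) : maskSq N (t + N) = maskSq N t := by
  have hNR : (N : ℝ) ≠ 0 := by positivity
  rw [maskSq, add_div, div_self hNR, mask_add_one, maskSq]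

lemma sum_maskSq (hN : 0 < N) (t : ℝ) : ∑ i ∈ Finset.range N, maskSq N (t + i) = 1 := by
  have := sum_normSq_mask hN t
  apply NNReal.coe_injective
  push_cast [maskSq]
  exact this

lemma maskSq_eq_zero (hN : 0 < N) {t : ℝ} (h : maskSq N t = 0) :
    ∃ a : ℤ, ¬ (N : ℤ) ∣ a ∧ t = a := by
  obtain ⟨a, ha, hta⟩ := mask_eq_zero hN (nnnorm_eq_zero.1 (pow_eq_zero_iff two_ne_zero |>.1 h))
  have hNR : (N : ℝ) ≠ 0 := by positivity
  exact ⟨a, ha, by rw [← hta]; field_simp⟩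

lemma maskSq_eq_zero_of_int (hN : 0 < N) {a : ℤ} (ha : ¬ (N : ℤ) ∣ a) :
    maskSq N a = 0 := by
  have hNR : (N : ℝ) ≠ 0 := by positivity
  rw [maskSq, mask_eq_zero_of_int hN ha (by field_simp)]
  simp

lemma maskSq_lt_one (hN : 1 < N) {t : ℝ} (ht : ∀ z : ℤ, t ≠ N * z) : maskSq N t < 1 := by
  have hN0 : 0 < N := by omega
  have hsum := sum_maskSq hN0 t
  have hsub : ({0, 1} : Finset ℕ) ⊆ Finset.range N := by
    intro i hi
    simp only [Finset.mem_insert, Finset.mem_singleton] at hi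
    rw [Finset.mem_range]
    omega
  have hle := Finset.sum_le_sum_of_subset (f := fun i : ℕ => maskSq N (t + i)) hsub
  rw [hsum, Finset.sum_pair zero_ne_one] at hle
  simp only [Nat.cast_zero, add_zero, Nat.cast_one] at hle
  by_contra! hge
  have h1 : maskSq N (t + 1) = 0 := by
    have := (add_le_add_left hge (maskSq N (t + 1))).trans hle
    simpa using this
  obtain ⟨a, -, hta⟩ := maskSq_eq_zero hN0 h1
  have h2 : t = ((a - 1 : ℤ) : ℝ) := by push_cast; linarith
  by_cases hd : (N : ℤ) ∣ a - 1
  · obtain ⟨b, hb⟩ := hd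
    exact ht b (by rw [h2, hb]; push_cast; ring)
  · rw [h2, maskSq_eq_zero_of_int hN0 hd] at hge
    exact absurd hge (by simp)

lemma maskSq_gap (hN : 1 < N) {δ : ℝ} (hδ : 0 < δ) :
    ∃ θ < (1 : ℝ≥0), ∀ t : ℝ, (∀ z : ℤ, δ ≤ |t - N * z|) → maskSq N t ≤ θ := by
  have hNR : (0 : ℝ) < N := by positivity
  have hclosed : IsClosed {t : ℝ | ∀ z : ℤ, δ ≤ |t - N * z|} := by
    rw [Set.ofPred_forall]
    exact isClosed_iInter fun z => isClosed_le continuous_const (by fun_prop)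
  have hcomp : IsCompact (Set.Icc (0 : ℝ) N ∩ {t : ℝ | ∀ z : ℤ, δ ≤ |t - N * z|}) :=
    isCompact_Icc.inter_right hclosed
  have hred : ∀ t : ℝ, (∀ z : ℤ, δ ≤ |t - N * z|) →
      ∃ s ∈ Set.Icc (0 : ℝ) N ∩ {t : ℝ | ∀ z : ℤ, δ ≤ |t - N * z|}, maskSq N s = maskSq N t := by
    intro t ht
    refine ⟨t - N * ⌊t / N⌋, ⟨⟨?_, ?_⟩, ?_⟩, ?_⟩
    · have := Int.floor_le (t / N)
      rw [le_div_iff₀ hNR] at this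
      linarith
    · have := Int.lt_floor_add_one (t / N)
      rw [div_lt_iff₀ hNR] at this
      linarith
    · intro z
      have := ht (⌊t / N⌋ + z)
      push_cast at this
      rwa [mul_add, ← sub_sub] at this
    · have hp : Function.Periodic (maskSq N) (N : ℝ) := maskSq_add (by omega)
      have := hp.sub_int_mul_eq ⌊t / N⌋ (x := t)
      rwa [mul_comm] at this
  rcases Set.eq_empty_or_nonempty
    (Set.Icc (0 : ℝ) N ∩ {t : ℝ | ∀ z : ℤ, δ ≤ |t - N * z|}) with he | hne
  · refine ⟨0, one_pos, fun t ht => ?_⟩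
    obtain ⟨s, hs, -⟩ := hred t ht
    rw [he] at hs
    exact hs.elim
  · obtain ⟨s, hs, hmax⟩ := hcomp.exists_isMaxOn hne maskSq_continuous.continuousOn
    refine ⟨maskSq N s, maskSq_lt_one hN fun z hz => ?_, fun t ht => ?_⟩
    · have := hs.2 z
      rw [hz, sub_self, abs_zero] at this
      linarith
    · obtain ⟨s', hs', he⟩ := hred t ht
      rw [← he]
      exact hmax hs'

lemma ftSq_eq_inner [IsProbabilityMeasure μ] (x l : ℝ) :
    (ftSq μ N (x + l) : ℝ) = ‖(inner ℂ (expLp μ (-l / N)) (expLp μ (x / N)) : ℂ)‖ ^ 2 := by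
  rw [inner_expLp_expLp, ftSq, show x / N - -l / N = (x + l) / N by ring]
  simp

lemma IsSelfSimilar.orthonormal [IsProbabilityMeasure μ] (hμ : IsSelfSimilar ρ N μ) (hN : 0 < N)
    {Λ : Set ℝ} (hΛ : IsBizero ρ N Λ) :
    Orthonormal ℂ (fun l : Λ => expLp μ (-(l : ℝ) / N)) := by
  refine ⟨fun l => norm_expLp _, fun l l' hne => ?_⟩
  change inner ℂ (expLp μ (-(l : ℝ) / N)) (expLp μ (-(l' : ℝ) / N)) = 0
  rw [inner_expLp_expLp, show -(l' : ℝ) / N - -(l : ℝ) / N = (l - l') / N by ring]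
  exact hμ.FT_eq_zero_of_mem hN (hΛ l l.2 l' l'.2 fun h => hne (Subtype.ext h))

lemma IsSelfSimilar.tsum_ftSq_le [IsProbabilityMeasure μ] (hμ : IsSelfSimilar ρ N μ) (hN : 0 < N)
    {Λ : Set ℝ} (hΛ : IsBizero ρ N Λ) (x : ℝ) :
    ∑' l : Λ, (ftSq μ N (x + l) : ℝ≥0∞) ≤ 1 := by
  rw [ENNReal.tsum_eq_iSup_sum]
  refine iSup_le fun R => ?_
  have h1 := (hμ.orthonormal hN hΛ).sum_inner_products_le (x := expLp μ (x / N)) (s := R)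
  simp only [norm_expLp, one_pow, ← ftSq_eq_inner] at h1
  exact_mod_cast h1

lemma IsSelfSimilar.maskSystem [IsProbabilityMeasure μ] (hμ : IsSelfSimilar ρ N μ)
    (hρ0 : 0 < ρ) (hρ1 : ρ < 1) (hN : 1 < N) : MaskSystem ρ N (maskSq N) (ftSq μ N) where
  scale t := by
    rw [ftSq, hμ.FT_eq, nnnorm_mul, mul_pow, maskSq, ftSq, mul_div_assoc]
  periodic := maskSq_add (by omega)
  sum_shift := sum_maskSq (by omega)
  mask_ne_zero t ht h0 := by
    obtain ⟨a, -, ha⟩ := maskSq_eq_zero (by omega) h0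
    exact ht a ha
  ne_zero t ht h0 := ht (hμ.mem_zeroSet hρ0 hρ1 (by omega)
    (nnnorm_eq_zero.1 (pow_eq_zero_iff two_ne_zero |>.1 h0)))
  bessel Λ hΛ x := hμ.tsum_ftSq_le (by omega) hΛ x
  gap δ hδ := maskSq_gap hN hδ

lemma ExpTotal.hasSum [IsProbabilityMeasure μ] {Λ : Set ℝ} (ho : ExpOrthonormal μ Λ)
    (ht : ExpTotal μ Λ) (ξ : ℝ) : HasSum (fun l : Λ => ‖FT μ (ξ - l)‖ ^ 2) 1 := by
  have hv : Orthonormal ℂ (fun l : Λ => expLp μ l) := by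
    refine ⟨fun l => norm_expLp _, fun l l' hne => ?_⟩
    change inner ℂ (expLp μ l) (expLp μ l') = 0
    rw [inner_expLp_expLp, ho l' l'.2 l l.2, if_neg fun h => hne (Subtype.ext h.symm)]
  have hsp : (Submodule.span ℂ (Set.range fun l : Λ => expLp μ l))ᗮ = ⊥ := by
    rw [Submodule.eq_bot_iff]
    intro f hf
    refine ht f fun l hl => ?_
    rw [← inner_expLp]
    exact (Submodule.mem_orthogonal _ _).1 hf _ (Submodule.subset_span ⟨⟨l, hl⟩, rfl⟩)
  have h := (HilbertBasis.mkOfOrthogonalEqBot hv hsp).hasSum_inner_mul_inner (expLp μ ξ) (expLp μ ξ)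
  rw [HilbertBasis.coe_mkOfOrthogonalEqBot, inner_expLp_expLp, sub_self, FT_zero] at h
  rw [← Complex.hasSum_ofReal, Complex.ofReal_one]
  refine h.congr_fun fun l => ?_
  rw [← inner_expLp_expLp, ← inner_conj_symm (expLp μ ξ), mul_comm]
  exact_mod_cast (Complex.mul_conj' _).symm

lemma ExpTotal.exists_isFull [IsProbabilityMeasure μ] (hμ : IsSelfSimilar ρ N μ)
    (hρ0 : 0 < ρ) (hρ1 : ρ < 1) (hN : 1 < N) {Λ : Set ℝ} (ho : ExpOrthonormal μ Λ)
    (ht : ExpTotal μ Λ) {K : Subfield ℝ} (hK : ρ ∈ K) {x : ℝ} (hx : x ∉ K) :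
    ∃ Λ' : Set ℝ, (0 : ℝ) ∈ Λ' ∧ IsFull ρ N (ftSq μ N) K Λ' x := by
  have hNR : (N : ℝ) ≠ 0 := by positivity
  obtain ⟨l₀, hl₀⟩ : Λ.Nonempty := by
    by_contra! he
    subst he
    exact one_ne_zero ((ht.hasSum ho 0).unique hasSum_empty)
  set g : ℝ → ℝ := fun l => N * (l₀ - l) with hg
  have hinj : Function.Injective g := fun l l' h => by
    simp only [hg] at h
    have := mul_left_cancel₀ hNR h
    linarith
  have h0 : (0 : ℝ) ∈ g '' Λ := ⟨l₀, hl₀, by simp [hg]⟩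
  have hbi : IsBizero ρ N (g '' Λ) := by
    rintro _ ⟨l, hl, rfl⟩ _ ⟨l', hl', rfl⟩ hne
    refine hμ.mem_zeroSet hρ0 hρ1 (by omega) ?_
    rw [show (g l - g l') / N = l' - l by simp only [hg]; field_simp; ring, ho l' hl' l hl,
      if_neg fun h => hne (by rw [h])]
  refine ⟨g '' Λ, h0, fun l hl => ?_, hx, hbi, ?_⟩
  · by_cases hl0 : l = 0
    · rw [hl0]; exact zero_mem K
    · have := zeroSet_subset hρ0 hK (hbi l hl 0 h0 hl0)
      rwa [sub_zero] at this
  · rw [tsum_image (fun l => (ftSq μ N (x + l) : ℝ≥0∞)) hinj.injOn]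
    have h1 := ht.hasSum ho (x / N + l₀)
    have h2 : ∀ l : Λ, (ftSq μ N (x + g l) : ℝ) = ‖FT μ (x / N + l₀ - l)‖ ^ 2 := fun l => by
      rw [ftSq, show (x + g l) / N = x / N + l₀ - l by simp only [hg]; field_simp; ring]
      simp
    simp_rw [← h2] at h1
    have h3 : HasSum (fun l : Λ => ftSq μ N (x + g l)) 1 := by
      rw [← NNReal.hasSum_coe, NNReal.coe_one]
      exact h1
    rw [← ENNReal.coe_tsum h3.summable, h3.tsum_eq, ENNReal.coe_one]

lemma exists_notMem_closure (ρ : ℝ) : ∃ x : ℝ, |x| ≤ 1 ∧ x ∉ Subfield.closure {ρ} := by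
  have h1 : (Subfield.closure {ρ} : Set ℝ).Countable := by
    rw [← Cardinal.le_aleph0_iff_set_countable]
    refine (Subfield.cardinalMk_closure_le_max {ρ}).trans ?_
    simp
  have h2 : ¬ (Set.Icc (-1 : ℝ) 1).Countable := Cardinal.Real.Icc_countable_iff.not.2 (by norm_num)
  by_contra! hcon
  exact h2 (h1.mono fun x hx => hcon x (abs_le.2 hx))

theorem IsSpectral.exists_eq_inv [IsProbabilityMeasure μ] (hμ : IsSelfSimilar ρ N μ)
    (hρ0 : 0 < ρ) (hρ1 : ρ < 1) (hN : 1 < N) (h : IsSpectral μ) :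
    ∃ q : ℕ, 1 < q ∧ N ∣ q ∧ ρ = 1 / (q : ℝ) := by
  obtain ⟨Λ, -, ho, ht⟩ := h
  obtain ⟨x, hx1, hx⟩ := exists_notMem_closure ρ
  have hK : ρ ∈ Subfield.closure {ρ} := Subfield.subset_closure rfl
  obtain ⟨Λ', h0, hfull⟩ := ht.exists_isFull hμ hρ0 hρ1 hN ho hK hx
  have hsys := hμ.maskSystem hρ0 hρ1 hN
  have hrat := hfull.not_irrational hsys hN hρ0 hK h0
  rw [Irrational, not_not] at hrat
  obtain ⟨r, rfl⟩ := hrat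
  have hr0 : 0 < r := by exact_mod_cast hρ0
  have hr1 : r < 1 := by exact_mod_cast hρ1
  have hnum : (r.num.toNat : ℤ) = r.num := Int.toNat_of_nonneg (Rat.num_pos.2 hr0).le
  have hrq : r = (r.num.toNat : ℚ) / (r.den : ℚ) := by
    rw [show (r.num.toNat : ℚ) = r.num by exact_mod_cast congrArg (Int.cast : ℤ → ℚ) hnum,
      Rat.num_div_den]
  have hpq : (r : ℝ) = (r.num.toNat : ℝ) / (r.den : ℝ) := by
    have := congrArg (Rat.cast : ℚ → ℝ) hrq
    push_cast at this
    exact this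
  have hp : 0 < r.num.toNat := by have := Rat.num_pos.2 hr0; omega
  have hlt : r.num.toNat < r.den := by
    have := Rat.num_lt_denom_iff.2 hr1
    omega
  have hc : r.num.toNat.Coprime r.den := by
    have := r.reduced
    rwa [show r.num.natAbs = r.num.toNat by omega] at this
  have hone := hfull.numerator_eq_one hsys hN hK h0 hx1 hp hlt hpq hc
  rw [hone] at hpq
  exact ⟨r.den, by omega, hfull.dvd_denom hsys hN hρ0 hK h0 (by omega) (by rw [hpq]) (by simp),
    by rw [hpq]; simp⟩

end

/-- The integer whose digits in the negative base `-q` are the base `N` digits of `m`. -/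
def negBase (q N m : ℕ) : ℤ := Nat.ofDigits (-q : ℤ) (Nat.digits N m)

section

variable {ρ : ℝ} {q N : ℕ} {M F : ℝ → ℝ≥0} {x : ℝ} {μ : Measure ℝ}

lemma negBase_zero : negBase q N 0 = 0 := by simp [negBase, Nat.ofDigits]

lemma negBase_eq (hN : 1 < N) (m : ℕ) :
    negBase q N m = (m % N : ℕ) - q * negBase q N (m / N) := by
  rcases Nat.eq_zero_or_pos m with rfl | hm
  · simp [negBase_zero]
  · rw [negBase, Nat.digits_def' hN hm, negBase]
    change ((m % N : ℕ) : ℤ) + -(q : ℤ) * _ = _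
    ring

lemma negBase_add_mul (hN : 1 < N) {d : ℕ} (hd : d < N) (m : ℕ) :
    negBase q N (d + N * m) = d - q * negBase q N m := by
  rw [negBase_eq hN, Nat.add_mul_mod_self_left, Nat.mod_eq_of_lt hd,
    Nat.add_mul_div_left _ _ (by omega), Nat.div_eq_of_lt hd, zero_add]

lemma exists_negBase_sub_of_lt (hN : 1 < N) (hNq : N ∣ q) (n : ℕ) :
    ∀ m < N ^ n, ∀ m' < N ^ n, m ≠ m' →
      ∃ (k : ℕ) (a : ℤ), ¬ (N : ℤ) ∣ a ∧ negBase q N m - negBase q N m' = q ^ k * a := by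
  induction n with
  | zero =>
    intro m hm m' hm' hne
    simp only [pow_zero, Nat.lt_one_iff] at hm hm'
    exact absurd (hm.trans hm'.symm) hne
  | succ n ih =>
    intro m hm m' hm' hne
    rw [pow_succ'] at hm hm'
    rw [negBase_eq hN m, negBase_eq hN m']
    by_cases hmod : m % N = m' % N
    · have hdiv : m / N ≠ m' / N := fun h => hne (by
        rw [← Nat.mod_add_div m N, ← Nat.mod_add_div m' N, hmod, h])
      obtain ⟨k, a, ha, h⟩ := ih (m / N) (Nat.div_lt_of_lt_mul hm) _
        (Nat.div_lt_of_lt_mul hm') hdiv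
      refine ⟨k + 1, -a, by rwa [dvd_neg], ?_⟩
      rw [hmod]
      linear_combination -(q : ℤ) * h
    · refine ⟨0, ((m % N : ℕ) - q * negBase q N (m / N)) -
        ((m' % N : ℕ) - q * negBase q N (m' / N)), fun hd => hmod ?_, by rw [pow_zero, one_mul]⟩
      obtain ⟨c, hc⟩ := hd
      obtain ⟨r, rfl⟩ := hNq
      have h2 : (N : ℤ) ∣ ((m % N : ℕ) : ℤ) - (m' % N : ℕ) := by
        refine ⟨c + r * (negBase (N * r) N (m / N) - negBase (N * r) N (m' / N)), ?_⟩
        rw [Nat.cast_mul] at hc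
        linear_combination hc
      have h3 := (Nat.modEq_iff_dvd.2 h2).symm
      rwa [Nat.ModEq, Nat.mod_mod, Nat.mod_mod] at h3

lemma exists_negBase_sub (hN : 1 < N) (hNq : N ∣ q) {m m' : ℕ} (h : m ≠ m') :
    ∃ (k : ℕ) (a : ℤ), ¬ (N : ℤ) ∣ a ∧ negBase q N m - negBase q N m' = q ^ k * a :=
  exists_negBase_sub_of_lt hN hNq (m + m') m
    ((Nat.le_add_right m m').trans_lt (Nat.lt_pow_self hN)) m'
    ((Nat.le_add_left m' m).trans_lt (Nat.lt_pow_self hN)) h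

lemma negBase_bounds (hN : 1 < N) (hNq : N ≤ q) (n : ℕ) :
    ∀ m < N ^ n, -(q : ℤ) ^ (n + 1) + q ≤ (q + 1) * negBase q N m ∧
      (q + 1) * negBase q N m ≤ (q : ℤ) ^ (n + 1) - 1 := by
  induction n with
  | zero =>
    intro m hm
    have : m = 0 := by simpa using hm
    rw [this, negBase_zero]
    simp
    omega
  | succ n ih =>
    intro m hm
    obtain ⟨h1, h2⟩ := ih (m / N) (Nat.div_lt_of_lt_mul (by rwa [pow_succ'] at hm))
    have hd : ((m % N : ℕ) : ℤ) + 1 ≤ q := by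
      have := Nat.mod_lt m (show 0 < N by omega)
      omega
    have hd0 : (0 : ℤ) ≤ (m % N : ℕ) := by positivity
    have hq0 : (0 : ℤ) ≤ q := by positivity
    rw [negBase_eq hN, pow_succ (q : ℤ) (n + 1)]
    constructor <;> nlinarith

lemma abs_pow_mul_negBase_le (hN : 1 < N) (hNq : N ≤ q) (hρ : ρ = 1 / q) {n m : ℕ}
    (hm : m < N ^ n) : |ρ ^ n * negBase q N m| ≤ q / (q + 1) := by
  have hq : (0 : ℝ) < q := by exact_mod_cast (by omega : 0 < q)
  obtain ⟨h1, h2⟩ := negBase_bounds hN hNq n m hm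
  have h1' : -(q : ℝ) ^ (n + 1) + q ≤ (q + 1) * negBase q N m := by exact_mod_cast h1
  have h2' : (q + 1) * (negBase q N m : ℝ) ≤ (q : ℝ) ^ (n + 1) - 1 := by exact_mod_cast h2
  have h3 : (q + 1) * |(negBase q N m : ℝ)| ≤ q ^ (n + 1) := by
    rw [← abs_of_pos (show (0 : ℝ) < q + 1 by positivity), ← abs_mul, abs_le]
    constructor <;> linarith
  rw [abs_mul, hρ, abs_of_pos (by positivity), le_div_iff₀ (by positivity), div_pow, one_pow,
    one_div, mul_assoc, inv_mul_le_iff₀ (by positivity), ← pow_succ]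
  linarith

lemma sum_range_pow_succ {R : Type*} [AddCommMonoid R] (hN : 0 < N) (n : ℕ) (f : ℕ → R) :
    ∑ m ∈ Finset.range (N ^ (n + 1)), f m =
      ∑ d ∈ Finset.range N, ∑ m ∈ Finset.range (N ^ n), f (d + N * m) := by
  rw [← Finset.sum_product']
  refine Finset.sum_nbij' (fun m => (m % N, m / N)) (fun p => p.1 + N * p.2) ?_ ?_ ?_ ?_ ?_
  · intro m hm
    rw [Finset.mem_range] at hm
    rw [Finset.mem_product, Finset.mem_range, Finset.mem_range]
    exact ⟨Nat.mod_lt _ hN, Nat.div_lt_of_lt_mul (by rwa [pow_succ'] at hm)⟩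
  · rintro ⟨d, m⟩ h
    rw [Finset.mem_product, Finset.mem_range, Finset.mem_range] at h
    rw [Finset.mem_range, pow_succ']
    calc d + N * m < N + N * m := by have := h.1; simp only at this; omega
      _ = N * (m + 1) := by ring
      _ ≤ N * N ^ n := Nat.mul_le_mul_left _ h.2
  · intro m _
    exact Nat.mod_add_div m N
  · rintro ⟨d, m⟩ h
    rw [Finset.mem_product, Finset.mem_range, Finset.mem_range] at h
    simp only [Nat.add_mul_mod_self_left, Nat.mod_eq_of_lt h.1, Nat.add_mul_div_left _ _ hN,
      Nat.div_eq_of_lt h.1, zero_add]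
  · intro m _
    rw [Nat.mod_add_div]

lemma MaskSystem.sum_shift_neg (h : MaskSystem ρ N M F) (t : ℝ) :
    ∑ i ∈ Finset.range N, M (t - i) = 1 := by
  rw [← h.sum_shift (t - (N - 1)), ← Finset.sum_range_reflect]
  refine Finset.sum_congr rfl fun i hi => ?_
  rw [Finset.mem_range] at hi
  rw [Nat.cast_sub (by omega), Nat.cast_sub (by omega)]
  congr 1
  push_cast
  ring

lemma MaskSystem.sum_prod_negBase (h : MaskSystem ρ N M F) (hN : 1 < N) (hNq : N ∣ q)
    (hq : 0 < q) (hρ : ρ = 1 / q) (n : ℕ) : ∀ (s : ℤ) (_ : s = 1 ∨ s = -1) (x : ℝ),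
    ∑ m ∈ Finset.range (N ^ n), ∏ k ∈ Finset.range n, M (ρ ^ k * (x + s * negBase q N m)) = 1 := by
  have hq' : (q : ℝ) ≠ 0 := by positivity
  induction n with
  | zero => simp
  | succ n ih =>
    intro s hs x
    rw [sum_range_pow_succ (by omega)]
    have hstep : ∀ d ∈ Finset.range N, ∑ m ∈ Finset.range (N ^ n),
        ∏ k ∈ Finset.range (n + 1), M (ρ ^ k * (x + s * negBase q N (d + N * m))) =
          M (x + s * d) := by
      intro d hd
      rw [Finset.mem_range] at hd
      have := ih (-s) (by omega) (ρ * (x + s * d))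
      rw [← mul_one (M (x + s * d)), ← this, Finset.mul_sum]
      refine Finset.sum_congr rfl fun m _ => ?_
      rw [Finset.prod_range_succ', mul_comm, negBase_add_mul hN hd]
      congr 1
      · obtain ⟨c, rfl⟩ := hNq
        rw [pow_zero, one_mul, ← h.periodic_int (x + s * d) (-s * c * negBase (N * c) N m)]
        congr 1
        push_cast
        ring
      · refine Finset.prod_congr rfl fun k _ => ?_
        congr 1
        push_cast
        rw [pow_succ, hρ]
        field_simp
        ring
    rw [Finset.sum_congr rfl hstep]
    rcases hs with rfl | rfl
    · simpa using h.sum_shift x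
    · simpa [sub_eq_add_neg] using h.sum_shift_neg x

end

section

variable {ρ : ℝ} {q N : ℕ} {μ : Measure ℝ}

lemma one_le_abs_of_mem_zeroSet (hρ0 : 0 < ρ) (hρ1 : ρ < 1) {t : ℝ} (ht : t ∈ zeroSet ρ N) :
    1 ≤ |t| := by
  obtain ⟨n, a, ha, h⟩ := ht
  have ha0 : a ≠ 0 := by
    rintro rfl
    exact ha (dvd_zero _)
  have h1 : (1 : ℝ) ≤ |(a : ℝ)| := by exact_mod_cast Int.one_le_abs ha0
  rw [← h, abs_mul, abs_of_pos (pow_pos hρ0 n)] at h1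
  exact h1.trans (mul_le_of_le_one_right (abs_nonneg t) (pow_le_one₀ hρ0.le hρ1.le))

lemma ftSq_continuous [IsProbabilityMeasure μ] : Continuous (ftSq μ N) :=
  (FT_continuous.comp (continuous_id.div_const _)).nnnorm.pow 2

lemma ftSq_zero [IsProbabilityMeasure μ] : ftSq μ N 0 = 1 := by simp [ftSq, FT_zero]

lemma negBase_sub_mem_zeroSet (hN : 1 < N) (hNq : N ∣ q) (hq : 0 < q) (hρ : ρ = 1 / q) {m m' : ℕ}
    (h : m ≠ m') : (negBase q N m : ℝ) - negBase q N m' ∈ zeroSet ρ N := by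
  obtain ⟨k, a, ha, h⟩ := exists_negBase_sub hN hNq h
  refine ⟨k, a, ha, ?_⟩
  have h' : (negBase q N m : ℝ) - negBase q N m' = q ^ k * a := by exact_mod_cast h
  have hq' : (q : ℝ) ≠ 0 := by positivity
  rw [h', hρ, one_div, inv_pow]
  field_simp

lemma IsSelfSimilar.orthonormal_negBase [IsProbabilityMeasure μ] (hμ : IsSelfSimilar ρ N μ)
    (hN : 1 < N) (hNq : N ∣ q) (hq : 0 < q) (hρ : ρ = 1 / q) :
    Orthonormal ℂ (fun m : ℕ => expLp μ (-(negBase q N m : ℝ) / N)) := by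
  refine ⟨fun m => norm_expLp _, fun m m' hne => ?_⟩
  change inner ℂ (expLp μ _) (expLp μ _) = 0
  rw [inner_expLp_expLp, show -(negBase q N m' : ℝ) / N - -(negBase q N m : ℝ) / N =
    ((negBase q N m : ℝ) - negBase q N m') / N by ring]
  exact hμ.FT_eq_zero_of_mem (by omega) (negBase_sub_mem_zeroSet hN hNq hq hρ hne)

lemma IsSelfSimilar.hasSum_ftSq_negBase [IsProbabilityMeasure μ] (hμ : IsSelfSimilar ρ N μ)
    (hN : 1 < N) (hNq : N ∣ q) (hq : 1 < q) (hρ : ρ = 1 / q) (x : ℝ) :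
    HasSum (fun m : ℕ => (ftSq μ N (x + negBase q N m) : ℝ)) 1 := by
  have hq0 : (0 : ℝ) < q := by positivity
  have hρ0 : 0 < ρ := by rw [hρ]; positivity
  have hρ1 : ρ < 1 := by
    rw [hρ, div_lt_one hq0]
    exact_mod_cast hq
  have h := hμ.maskSystem hρ0 hρ1 hN
  have hsumm : Summable (fun m : ℕ => (ftSq μ N (x + negBase q N m) : ℝ)) := by
    have := (hμ.orthonormal_negBase hN hNq (by omega) hρ).inner_products_summable
      (x := expLp μ (x / N))
    simpa only [← ftSq_eq_inner] using this
  set c : ℝ := (q / (q + 1) + 1) / 2 with hc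
  have hlt : (q : ℝ) / (q + 1) < 1 := by
    rw [div_lt_one (by positivity)]
    linarith
  have hne : (Set.Icc (-c) c).Nonempty := ⟨0, by
    have : (0 : ℝ) ≤ q / (q + 1) := by positivity
    constructor <;> linarith⟩
  obtain ⟨s, hs, hmin⟩ := isCompact_Icc.exists_isMinOn hne
    (ftSq_continuous (μ := μ) (N := N)).continuousOn
  have hδ : ftSq μ N s ≠ 0 := h.ne_zero s fun hz => by
    have h1 := one_le_abs_of_mem_zeroSet hρ0 hρ1 hz
    have h2 := abs_le.2 hs
    linarith
  have hpow : Filter.Tendsto (fun n : ℕ => ρ ^ n) Filter.atTop (nhds 0) :=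
    tendsto_pow_atTop_nhds_zero_of_lt_one hρ0.le hρ1
  have hlim : ∀ m : ℕ, Filter.Tendsto (fun n : ℕ => (Set.Iio (N ^ n)).indicator (fun m : ℕ =>
      ((∏ k ∈ Finset.range n, maskSq N (ρ ^ k * (x + negBase q N m)) : ℝ≥0) : ℝ)) m)
      Filter.atTop (nhds (ftSq μ N (x + negBase q N m) : ℝ)) := by
    intro m
    set t : ℝ := x + negBase q N m
    have h1 : Filter.Tendsto (fun n : ℕ => ftSq μ N (ρ ^ n * t)) Filter.atTop (nhds 1) := by
      have := hpow.mul_const t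
      rw [zero_mul] at this
      have h2 := (ftSq_continuous (μ := μ) (N := N)).tendsto 0
      rw [ftSq_zero] at h2
      exact h2.comp this
    have h2 : Filter.Tendsto (fun n : ℕ => ftSq μ N t / ftSq μ N (ρ ^ n * t)) Filter.atTop
        (nhds (ftSq μ N t)) := by
      have := (tendsto_const_nhds (x := ftSq μ N t)).div h1 one_ne_zero
      rwa [div_one] at this
    refine (NNReal.tendsto_coe.2 h2).congr' ?_
    filter_upwards [h1.eventually_ne one_ne_zero, Filter.eventually_gt_atTop m] with n hn hnm
    have hmem : m ∈ Set.Iio (N ^ n) := hnm.trans (Nat.lt_pow_self hN)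
    rw [Set.indicator_of_mem hmem]
    congr 1
    rw [h.eq_prod_mul n t, mul_div_cancel_right₀ _ hn]
  have hbound : ∀ᶠ n : ℕ in Filter.atTop, ∀ m : ℕ, ‖(Set.Iio (N ^ n)).indicator (fun m : ℕ =>
      ((∏ k ∈ Finset.range n, maskSq N (ρ ^ k * (x + negBase q N m)) : ℝ≥0) : ℝ)) m‖ ≤
      (ftSq μ N s : ℝ)⁻¹ * ftSq μ N (x + negBase q N m) := by
    have h1 := (hpow.mul_const |x|).eventually_le_const (u := c - q / (q + 1))
      (by rw [zero_mul]; linarith)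
    filter_upwards [h1] with n hn m
    by_cases hm : m ∈ Set.Iio (N ^ n)
    · rw [Set.indicator_of_mem hm, Real.norm_of_nonneg (NNReal.coe_nonneg _),
        le_inv_mul_iff₀ (by positivity), mul_comm, h.eq_prod_mul n (x + negBase q N m),
        NNReal.coe_mul]
      gcongr
      refine hmin (abs_le.1 ?_)
      have h2 := abs_pow_mul_negBase_le hN (Nat.le_of_dvd (by omega) hNq) hρ hm
      rw [mul_add]
      refine (abs_add_le _ _).trans ?_
      rw [abs_mul (ρ ^ n) x, abs_of_pos (pow_pos hρ0 n)]
      linarith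
    · rw [Set.indicator_of_notMem hm, norm_zero]
      positivity
  have hconv := tendsto_tsum_of_dominated_convergence (hsumm.mul_left _) hlim hbound
  have hone : ∀ n : ℕ, ∑' m : ℕ, (Set.Iio (N ^ n)).indicator (fun m : ℕ =>
      ((∏ k ∈ Finset.range n, maskSq N (ρ ^ k * (x + negBase q N m)) : ℝ≥0) : ℝ)) m = 1 := by
    intro n
    rw [tsum_eq_sum (s := Finset.range (N ^ n)) fun m hm => Set.indicator_of_notMem
      (by simpa using hm) _]
    have h1 := h.sum_prod_negBase hN hNq (by omega) hρ n 1 (Or.inl rfl) x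
    simp only [Int.cast_one, one_mul] at h1
    rw [← NNReal.coe_one, ← h1, NNReal.coe_sum]
    refine Finset.sum_congr rfl fun m hm => Set.indicator_of_mem ?_ _
    simpa using hm
  simp only [hone] at hconv
  rw [← tendsto_nhds_unique hconv tendsto_const_nhds]
  exact hsumm.hasSum

/-- A vector orthogonal to an orthonormal family is orthogonal to every vector for which
Parseval's identity holds. -/
lemma Orthonormal.inner_eq_zero_of_hasSum {𝕜 E ι : Type*} [RCLike 𝕜] [NormedAddCommGroup E]
    [InnerProductSpace 𝕜 E] {v : ι → E} (hv : Orthonormal 𝕜 v) {f e : E}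
    (hf : ∀ i, inner 𝕜 (v i) f = 0) (he : HasSum (fun i => ‖inner 𝕜 (v i) e‖ ^ 2) (‖e‖ ^ 2)) :
    inner 𝕜 f e = 0 := by
  by_cases hf0 : f = 0
  · rw [hf0, inner_zero_left]
  have hnf : (‖f‖ : 𝕜) ≠ 0 := by exact_mod_cast norm_ne_zero_iff.2 hf0
  have hw : Orthonormal 𝕜 (fun o : Option ι => o.elim ((‖f‖ : 𝕜)⁻¹ • f) v) := by
    constructor
    · rintro (_ | i)
      · exact norm_smul_inv_norm hf0
      · exact hv.1 i
    · rintro (_ | i) (_ | j) hij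
      · exact absurd rfl hij
      · simp only [Option.elim_none, Option.elim_some]
        rw [inner_smul_left, inner_eq_zero_symm.1 (hf j), mul_zero]
      · simp only [Option.elim_none, Option.elim_some]
        rw [inner_smul_right, hf i, mul_zero]
      · exact hv.2 fun h => hij (by rw [h])
  have hle : ‖inner 𝕜 ((‖f‖ : 𝕜)⁻¹ • f) e‖ ^ 2 + ‖e‖ ^ 2 ≤ ‖e‖ ^ 2 := by
    refine le_of_tendsto (he.const_add _) (.of_forall fun s => ?_)
    have := hw.sum_inner_products_le (x := e) (s := s.insertNone)
    rwa [Finset.sum_insertNone] at this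
  have h0 : ‖inner 𝕜 ((‖f‖ : 𝕜)⁻¹ • f) e‖ ^ 2 ≤ 0 := by linarith
  have h1 : inner 𝕜 ((‖f‖ : 𝕜)⁻¹ • f) e = 0 :=
    norm_eq_zero.1 (pow_eq_zero_iff two_ne_zero |>.1 (le_antisymm h0 (by positivity)))
  rw [inner_smul_left] at h1
  exact (mul_eq_zero.1 h1).resolve_left (by simpa using hf0)

lemma ae_eq_zero_of_integral_mul_exp_eq_zero {u : ℝ → ℝ} (hu : Integrable u μ)
    (h : ∀ t : ℝ, ∫ x, (u x : ℂ) * cexp (t * x * I) ∂μ = 0) : u =ᵐ[μ] 0 := by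
  have hf1 := isFiniteMeasure_withDensity_ofReal hu.2
  have hf2 := isFiniteMeasure_withDensity_ofReal hu.neg.2
  have hm1 : AEMeasurable (fun x => ENNReal.ofReal (u x)) μ := hu.1.aemeasurable.ennreal_ofReal
  have hm2 : AEMeasurable (fun x => ENNReal.ofReal ((-u) x)) μ :=
    hu.neg.1.aemeasurable.ennreal_ofReal
  have hexp : ∀ (t : ℝ) (w : ℝ → ℝ), Integrable w μ →
      Integrable (fun x => (w x : ℂ) * cexp (t * x * I)) μ := fun t w hw =>
    hw.ofReal.mul_bdd (c := 1) (by fun_prop) (.of_forall fun x => by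
      rw [show (t * x * I : ℂ) = ((t * x : ℝ) : ℂ) * I by push_cast; ring,
        Complex.norm_exp_ofReal_mul_I])
  have heq : μ.withDensity (fun x => ENNReal.ofReal (u x)) =
      μ.withDensity (fun x => ENNReal.ofReal ((-u) x)) := by
    refine Measure.ext_of_charFun (funext fun t => ?_)
    rw [charFun_apply_real, charFun_apply_real,
      integral_withDensity_eq_integral_toReal_smul₀ hm1 (.of_forall fun _ => ENNReal.ofReal_lt_top),
      integral_withDensity_eq_integral_toReal_smul₀ hm2 (.of_forall fun _ => ENNReal.ofReal_lt_top),
      ← sub_eq_zero]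
    simp only [ENNReal.toReal_ofReal', Complex.real_smul]
    rw [← integral_sub (hexp t _ hu.pos_part) (hexp t _ hu.neg.pos_part), ← h t]
    refine integral_congr_ae (.of_forall fun x => ?_)
    simp only
    rw [← sub_mul, ← Complex.ofReal_sub, Pi.neg_apply, max_zero_sub_max_neg_zero_eq_self]
  rw [withDensity_eq_iff hm1 hm2 ((lintegral_mono fun x =>
    Real.ofReal_le_enorm (u x)).trans_lt hu.2).ne] at heq
  filter_upwards [heq] with x hx
  rcases le_total (u x) 0 with h0 | h0
  · rw [ENNReal.ofReal_of_nonpos h0, eq_comm, ENNReal.ofReal_eq_zero, Pi.neg_apply] at hx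
    exact le_antisymm h0 (neg_nonpos.1 hx)
  · rw [Pi.neg_apply, ENNReal.ofReal_of_nonpos (neg_nonpos.2 h0), ENNReal.ofReal_eq_zero] at hx
    exact le_antisymm hx h0

lemma eq_zero_of_inner_expLp_eq_zero [IsProbabilityMeasure μ] {f : Lp ℂ 2 μ}
    (h : ∀ ξ : ℝ, inner ℂ (expLp μ ξ) f = 0) : f = 0 := by
  have hf : Integrable f μ := (Lp.memLp f).integrable one_le_two
  have h1 : ∀ t : ℝ, ∫ x, f x * cexp (t * x * I) ∂μ = 0 := by
    intro t
    rw [← h (t / (2 * π)), inner_expLp]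
    refine integral_congr_ae (.of_forall fun x => ?_)
    simp only
    rw [← Complex.exp_conj]
    congr 2
    have hpi : (π : ℂ) ≠ 0 := by exact_mod_cast Real.pi_ne_zero
    simp only [map_mul, map_neg, Complex.conj_ofReal, Complex.conj_I, map_ofNat]
    push_cast
    field_simp
  have hexp : ∀ t : ℝ, Integrable (fun x => f x * cexp (t * x * I)) μ := fun t =>
    hf.mul_bdd (c := 1) (by fun_prop) (.of_forall fun x => by
      rw [show (t * x * I : ℂ) = ((t * x : ℝ) : ℂ) * I by push_cast; ring,
        Complex.norm_exp_ofReal_mul_I])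
  have hconj : ∀ (t x : ℝ), (starRingEnd ℂ) (f x) * cexp (t * x * I) =
      (starRingEnd ℂ) (f x * cexp ((-t : ℝ) * x * I)) := by
    intro t x
    rw [map_mul, ← Complex.exp_conj]
    simp
  have h2 : ∀ t : ℝ, ∫ x, (starRingEnd ℂ) (f x) * cexp (t * x * I) ∂μ = 0 := by
    intro t
    simp_rw [hconj]
    rw [integral_conj, h1, map_zero]
  have hexp2 : ∀ t : ℝ, Integrable (fun x => (starRingEnd ℂ) (f x) * cexp (t * x * I)) μ := by
    intro t
    simp_rw [hconj]
    exact (RCLike.conjCLE (K := ℂ)).toContinuousLinearMap.integrable_comp (hexp (-t))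
  have hre : (fun x => (f x).re) =ᵐ[μ] 0 := by
    refine ae_eq_zero_of_integral_mul_exp_eq_zero hf.re fun t => ?_
    have := integral_add (hexp t) (hexp2 t)
    rw [h1, h2, add_zero] at this
    rw [← mul_zero (2⁻¹ : ℂ), ← this, ← integral_const_mul]
    refine integral_congr_ae (.of_forall fun x => ?_)
    simp only
    rw [Complex.re_eq_add_conj]
    ring
  have him : (fun x => (f x).im) =ᵐ[μ] 0 := by
    refine ae_eq_zero_of_integral_mul_exp_eq_zero hf.im fun t => ?_
    have := integral_sub (hexp t) (hexp2 t)
    rw [h1, h2, sub_zero] at this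
    rw [← mul_zero ((2 * I)⁻¹ : ℂ), ← this, ← integral_const_mul]
    refine integral_congr_ae (.of_forall fun x => ?_)
    simp only
    rw [Complex.im_eq_sub_conj]
    ring
  rw [Lp.eq_zero_iff_ae_eq_zero]
  filter_upwards [hre, him] with x hx hx'
  exact Complex.ext hx hx'

theorem IsSelfSimilar.isSpectral [IsProbabilityMeasure μ] (hμ : IsSelfSimilar ρ N μ)
    (hN : 1 < N) (hNq : N ∣ q) (hq : 1 < q) (hρ : ρ = 1 / q) : IsSpectral μ := by
  have hv := hμ.orthonormal_negBase hN hNq (by omega) hρ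
  refine ⟨Set.range fun m : ℕ => -(negBase q N m : ℝ) / N, Set.countable_range _, ?_, ?_⟩
  · rintro _ ⟨m, rfl⟩ _ ⟨m', rfl⟩
    simp only
    rw [← inner_expLp_expLp]
    by_cases hmm : m = m'
    · subst hmm
      rw [if_pos rfl, inner_expLp_expLp, sub_self, FT_zero]
    · have h0 := hv.2 (Ne.symm hmm)
      simp only at h0
      rw [h0, if_neg fun he => ?_]
      rw [he, inner_expLp_expLp, sub_self, FT_zero] at h0
      exact one_ne_zero h0
  · intro f hf
    refine eq_zero_of_inner_expLp_eq_zero fun ξ => inner_eq_zero_symm.1 ?_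
    refine hv.inner_eq_zero_of_hasSum (fun m => ?_) ?_
    · rw [inner_expLp]
      exact hf _ ⟨m, rfl⟩
    · have hNR : (N : ℝ) ≠ 0 := by positivity
      have := hμ.hasSum_ftSq_negBase hN hNq hq hρ (ξ * N)
      simp only [ftSq_eq_inner, mul_div_cancel_right₀ _ hNR] at this
      rwa [norm_expLp, one_pow]

end

theorem stmt_19 (ρ : ℝ) (hρ : 0 < ρ ∧ ρ < 1) (N : ℕ) (hN : 1 < N)
    (μ : Measure ℝ) [IsProbabilityMeasure μ] (hμ : IsSelfSimilar ρ N μ) :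
    IsSpectral μ ↔ ∃ q : ℕ, 1 < q ∧ N ∣ q ∧ ρ = 1 / (q : ℝ) := by
  refine ⟨fun h => h.exists_eq_inv hμ hρ.1 hρ.2 hN, ?_⟩
  rintro ⟨q, hq, hNq, hρq⟩
  exact hμ.isSpectral hN hNq hq hρq
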